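/- arXiv:0901.0686 — 7 statements merged into one kernel-verified Lean document; each statement's English description precedes it below -/
import Mathlib

section
/- Let k be a field, let n ≥ 2 be an integer, and let g be a nonzero polynomial in k[x_1,…,x_d]. If the hypersurface ring R = k[z,x_1,…,x_d]/(z^n − g) is a normal domain (an integral domain that is integrally closed in its fraction field), then g is squarefree in k[x_1,…,x_d]. -/
/-- If a monic polynomial `f` divides `X ^ m - C p * q` with `m < deg f`, then `p` is a unit. -/
theorem isUnit_of_monic_dvd_X_pow_sub_C_mul {A : Type*} [CommRing A] {f q : Polynomial A}
    (hf : f.Monic) {m : ℕ} (hm : m < f.natDegree) {p : A}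
    (h : f ∣ Polynomial.X ^ m - Polynomial.C p * q) : IsUnit p := by
  nontriviality A
  have hX : (Polynomial.X ^ m : Polynomial A) %ₘ f = Polynomial.X ^ m := by
    rw [Polynomial.modByMonic_eq_self_iff hf, Polynomial.degree_X_pow,
      Polynomial.degree_eq_natDegree hf.ne_zero]
    exact_mod_cast hm
  have key : (Polynomial.X ^ m : Polynomial A) = Polynomial.C p * (q %ₘ f) := by
    rw [← Polynomial.modByMonic_eq_zero_iff_dvd hf, Polynomial.sub_modByMonic, hX,
      ← Polynomial.smul_eq_C_mul, Polynomial.smul_modByMonic, sub_eq_zero] at h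
    rw [h, Polynomial.smul_eq_C_mul]
  have hcoeff := congrArg (fun r => r.coeff m) key
  simp only [Polynomial.coeff_X_pow_self, Polynomial.coeff_C_mul] at hcoeff
  exact IsUnit.of_mul_eq_one _ hcoeff.symm


/-- Let `k` be a field, `n ≥ 2` an integer, and `g` a nonzero polynomial in
`k[x_1,…,x_d]`.  If the hypersurface ring `R = k[z,x_1,…,x_d]/(zⁿ − g)` is a normal domain
(an integral domain that is integrally closed in its fraction field), then `g` is squarefree
in `k[x_1,…,x_d]`.  Here `k[z,x_1,…,x_d]` is realized as the polynomial ring in `z` over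
`k[x_1,…,x_d]`, so `z = Polynomial.X` and `g` is included via `Polynomial.C`. -/
theorem divisor_class_stmt_0 {k : Type*} [Field k] {d n : ℕ} (hn : 2 ≤ n)
    (g : MvPolynomial (Fin d) k) (hg : g ≠ 0)
    [IsDomain (Polynomial (MvPolynomial (Fin d) k) ⧸
      Ideal.span {Polynomial.X ^ n - Polynomial.C g})]
    [IsIntegrallyClosed (Polynomial (MvPolynomial (Fin d) k) ⧸
      Ideal.span {Polynomial.X ^ n - Polynomial.C g})] :
    Squarefree g := by
  rintro p ⟨h, rfl⟩
  set f : Polynomial (MvPolynomial (Fin d) k) :=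
    Polynomial.X ^ n - Polynomial.C (p * p * h) with hf
  let π := Ideal.Quotient.mk (Ideal.span {f})
  have hz : π Polynomial.X ^ n = π (Polynomial.C (p * p * h)) := by
    rw [← map_pow]
    exact Ideal.Quotient.eq.mpr (Ideal.mem_span_singleton_self f)
  have hsq : π (Polynomial.C p) ^ 2 ∣ (π Polynomial.X ^ (n - 1)) ^ 2 := by
    refine ⟨π (Polynomial.C h) * π Polynomial.X ^ (n - 2), ?_⟩
    rw [← pow_mul, show (n - 1) * 2 = n + (n - 2) by omega, pow_add, hz]
    simp only [map_mul]
    ring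
  obtain ⟨r, hr⟩ := (IsIntegrallyClosed.pow_dvd_pow_iff
    (R := Polynomial (MvPolynomial (Fin d) k) ⧸ Ideal.span {f}) two_ne_zero).mp hsq
  obtain ⟨q, rfl⟩ := Ideal.Quotient.mk_surjective r
  have hmonic : f.Monic := Polynomial.monic_X_pow_sub_C _ (by omega)
  refine isUnit_of_monic_dvd_X_pow_sub_C_mul (q := q) (m := n - 1) hmonic ?_ ?_
  · rw [hf, Polynomial.natDegree_X_pow_sub_C]
    omega
  · rw [← Ideal.mem_span_singleton, ← Ideal.Quotient.eq, map_pow, map_mul]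
    exact hr
end

section
/- Let k be a field and let g ∈ k[x_1,…,x_d] be an irreducible polynomial that is weighted homogeneous of degree m with respect to positive integer weights c_1,…,c_d on the variables, with m relatively prime to n. If the hypersurface ring R = k[z,x_1,…,x_d]/(z^n − g) is a normal domain, then R is a unique factorization domain. -/
open Polynomial
open scoped LaurentPolynomial

/-- If the polynomial ring over a noetherian domain is a UFD, then so is the base ring. -/
theorem UniqueFactorizationMonoid.of_polynomial {S : Type*} [CommRing S] [IsDomain S]
    [IsNoetherianRing S] [UniqueFactorizationMonoid S[X]] : UniqueFactorizationMonoid S where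
  irreducible_iff_prime {a} := by
    refine ⟨fun ha ↦ ?_, Prime.irreducible⟩
    rw [← prime_C_iff, ← UniqueFactorizationMonoid.irreducible_iff_prime]
    refine ⟨fun h ↦ ha.not_isUnit (isUnit_C.mp h), fun p q hpq ↦ ?_⟩
    have hp : p ∣ C a := ⟨q, hpq⟩
    have hq : q ∣ C a := ⟨p, by rw [hpq, mul_comm]⟩
    have hdeg {r : S[X]} (hr : r ∣ C a) : r = C (r.coeff 0) :=
      eq_C_of_natDegree_eq_zero <| Nat.le_zero.mp <|
        (natDegree_le_of_dvd hr (C_ne_zero.mpr ha.ne_zero)).trans (natDegree_C a).le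
    rw [hdeg hp, hdeg hq, ← C_mul, C_inj] at hpq
    rw [hdeg hp, hdeg hq, isUnit_C, isUnit_C]
    exact ha.isUnit_or_isUnit hpq

/-- If the Laurent polynomial ring over a noetherian domain is a UFD, then so is the base ring. -/
theorem UniqueFactorizationMonoid.of_laurentPolynomial {S : Type*} [CommRing S] [IsDomain S]
    [IsNoetherianRing S] [UniqueFactorizationMonoid S[T;T⁻¹]] : UniqueFactorizationMonoid S :=
  have : UniqueFactorizationMonoid S[X] :=
    (UniqueFactorizationMonoid.iff_of_isLocalizationAway_of_prime prime_X S[T;T⁻¹]).mpr ‹_›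
  .of_polynomial

/-- The class of `X` in `A[X] ⧸ (f)` is prime as soon as `f` is prime and so is its constant
coefficient. -/
theorem Polynomial.prime_mk_X {A : Type*} [CommRing A] [IsDomain A] {f : A[X]}
    (hf : Prime f) (h0 : Prime (f.coeff 0)) :
    Prime (Ideal.Quotient.mk (Ideal.span {f}) X) := by
  have key (p : A[X]) : Ideal.Quotient.mk (Ideal.span {f}) X ∣ Ideal.Quotient.mk _ p ↔
      f.coeff 0 ∣ p.coeff 0 := by
    constructor
    · rintro ⟨q, hq⟩
      obtain ⟨q, rfl⟩ := Ideal.Quotient.mk_surjective q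
      rw [← map_mul, Ideal.Quotient.eq, Ideal.mem_span_singleton] at hq
      obtain ⟨r, hr⟩ := hq
      exact ⟨r.coeff 0, by simpa using congr_arg (coeff · 0) hr⟩
    · rintro ⟨r, hr⟩
      have : X ∣ p - f * C r := by simp [X_dvd_iff, hr]
      obtain ⟨q, hq⟩ := this
      refine ⟨Ideal.Quotient.mk _ q, ?_⟩
      rw [← map_mul, Ideal.Quotient.eq, Ideal.mem_span_singleton, ← hq]
      exact ⟨C r, by ring⟩
  refine ⟨fun h ↦ ?_, fun h ↦ ?_, fun a b hab ↦ ?_⟩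
  · rw [Ideal.Quotient.eq_zero_iff_mem, Ideal.mem_span_singleton] at h
    have := hf.associated_of_dvd prime_X h
    exact h0.ne_zero (X_dvd_iff.mp this.symm.dvd)
  · have := (key 1).mp h.dvd
    simp only [coeff_one_zero] at this
    exact h0.not_isUnit (isUnit_of_dvd_one this)
  · obtain ⟨p, rfl⟩ := Ideal.Quotient.mk_surjective a
    obtain ⟨q, rfl⟩ := Ideal.Quotient.mk_surjective b
    rw [← map_mul, key, mul_coeff_zero] at hab
    simpa only [key] using h0.dvd_or_dvd hab

namespace MvPolynomial

variable {σ k B : Type*} [CommRing k] [CommRing B]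

/-- The ring homomorphism obtained from `ι` by rescaling the image of each variable `X i` by
the `c i`-th power of the unit `τ`. -/
noncomputable def rescale (c : σ → ℕ) (ι : MvPolynomial σ k →+* B) (τ : Bˣ) :
    MvPolynomial σ k →+* B :=
  eval₂Hom (ι.comp C) fun i ↦ ↑(τ ^ c i) * ι (X i)

theorem rescale_C (c : σ → ℕ) (ι : MvPolynomial σ k →+* B) (τ : Bˣ) (a : k) :
    rescale c ι τ (C a) = ι (C a) := by
  simp [rescale]

theorem rescale_X (c : σ → ℕ) (ι : MvPolynomial σ k →+* B) (τ : Bˣ) (i : σ) :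
    rescale c ι τ (X i) = ↑(τ ^ c i) * ι (X i) := by
  simp [rescale]

theorem IsWeightedHomogeneous.rescale_apply {c : σ → ℕ} {m : ℕ} {g : MvPolynomial σ k}
    (hg : g.IsWeightedHomogeneous c m) (ι : MvPolynomial σ k →+* B) (τ : Bˣ) :
    rescale c ι τ g = ↑(τ ^ m) * ι g := by
  induction hg using IsWeightedHomogeneous.induction_on with
  | zero => simp
  | add p q _ _ hp hq => rw [map_add, map_add, hp, hq, mul_add]
  | monomial d r hr =>
    rw [monomial_eq, map_mul, map_mul, rescale_C, Finsupp.prod, map_prod, map_prod, ← hr,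
      Finsupp.weight_apply, Finsupp.sum, ← Finset.prod_pow_eq_pow_sum, mul_left_comm,
      Units.coe_prod, ← Finset.prod_mul_distrib]
    congr 1
    refine Finset.prod_congr rfl fun i _ ↦ ?_
    rw [map_pow, map_pow, rescale_X, mul_pow, smul_eq_mul, mul_comm (d i), pow_mul,
      Units.val_pow_eq_pow_val (τ ^ c i)]

end MvPolynomial

theorem LaurentPolynomial.ringHom_ext' {S B : Type*} [CommRing S] [CommRing B]
    {f f' : S[T;T⁻¹] →+* B} (hC : f.comp LaurentPolynomial.C = f'.comp LaurentPolynomial.C)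
    (hT : f (LaurentPolynomial.T 1) = f' (LaurentPolynomial.T 1)) : f = f' := by
  refine IsLocalization.ringHom_ext (Submonoid.powers (X : S[X])) (Polynomial.ringHom_ext' ?_ ?_)
  · ext a
    simpa using DFunLike.congr_fun hC a
  · simpa using hT

theorem RingHom.apply_val_of_units_map_eq {P Q : Type*} [Semiring P] [Semiring Q] {f : P →+* Q}
    {x : Pˣ} {y : Qˣ} (h : Units.map (f : P →* Q) x = y) : f x = y :=
  congr_arg Units.val h

theorem CommGroup.pow_zpow_mul_zpow_pow {G : Type*} [CommGroup G] {n m : ℕ} {α γ : ℤ}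
    (h : n * α - m * γ = 1) (t z : G) :
    (z ^ n * t⁻¹ ^ m) ^ γ * (t ^ α * (z ^ γ)⁻¹) ^ n = t ∧
    (z ^ n * t⁻¹ ^ m) ^ α * (t ^ α * (z ^ γ)⁻¹) ^ m = z := by
  have h' {M : Type _} [AddCommGroup M] (t z : M) :
      γ • ((n : ℤ) • z + (m : ℤ) • -t) + (n : ℤ) • (α • t + -(γ • z)) = t ∧
      α • ((n : ℤ) • z + (m : ℤ) • -t) + (m : ℤ) • (α • t + -(γ • z)) = z := by
    constructor
    · trans (n * α - m * γ) • t
      · module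
      · rw [h, one_smul]
    · trans (n * α - m * γ) • z
      · module
      · rw [h, one_smul]
  simp only [← zpow_natCast]
  exact h' (M := Additive G) t z

theorem CommGroup.zpow_mul_pow_zpow_mul {G : Type*} [CommGroup G] {n m : ℕ} {α γ : ℤ}
    (h : n * α - m * γ = 1) (u w : G) :
    (u ^ γ * w ^ n) ^ α * ((u ^ α * w ^ m) ^ γ)⁻¹ = w ∧
    (u ^ α * w ^ m) ^ n = (u ^ γ * w ^ n) ^ m * u := by
  have h' {M : Type _} [AddCommGroup M] (u w : M) :
      α • (γ • u + (n : ℤ) • w) + -(γ • (α • u + (m : ℤ) • w)) = w ∧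
      (n : ℤ) • (α • u + (m : ℤ) • w) = (m : ℤ) • (γ • u + (n : ℤ) • w) + u := by
    constructor
    · trans (n * α - m * γ) • w
      · module
      · rw [h, one_smul]
    · trans (m : ℤ) • (γ • u + (n : ℤ) • w) + (n * α - m * γ) • u
      · module
      · rw [h, one_smul]
  simp only [← zpow_natCast]
  exact h' (M := Additive G) u w

/-- The ring `A[z] ⧸ (z ^ n - g)`: the coordinate ring of the cyclic cover of degree `n` branched
along `g = 0`. -/
abbrev CyclicCover {A : Type*} [CommRing A] (g : A) (n : ℕ) : Type _ :=
  A[X] ⧸ Ideal.span {X ^ n - C g}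

namespace CyclicCover

section

variable {A : Type*} [CommRing A] (g : A) (n : ℕ)

/-- The class of `z` in `A[z] ⧸ (z ^ n - g)`. -/
noncomputable abbrev root : CyclicCover g n :=
  Ideal.Quotient.mk (Ideal.span {X ^ n - C g}) X

theorem root_pow : root g n ^ n = algebraMap A (CyclicCover g n) g := by
  rw [← map_pow]
  exact Ideal.Quotient.eq.mpr (Ideal.mem_span_singleton_self _)

variable {g n}
variable {S : Type*} [CommRing S] [Algebra (CyclicCover g n) S] [Algebra A S]
  [IsScalarTower A (CyclicCover g n) S]

variable (S) in
theorem algebraMap_root_pow :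
    algebraMap (CyclicCover g n) S (root g n) ^ n = algebraMap A S g := by
  rw [← map_pow, root_pow, ← IsScalarTower.algebraMap_apply]

variable [IsLocalization.Away (root g n) S] {B : Type*} [CommRing B]

theorem ringHom_ext {f f' : S →+* B}
    (hA : f.comp (algebraMap A S) = f'.comp (algebraMap A S))
    (hroot : f (algebraMap _ S (root g n)) = f' (algebraMap _ S (root g n))) : f = f' := by
  rw [IsScalarTower.algebraMap_eq A (CyclicCover g n) S] at hA
  refine IsLocalization.ringHom_ext (Submonoid.powers (root g n)) (Ideal.Quotient.ringHom_ext ?_)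
  exact Polynomial.ringHom_ext' hA hroot

variable (S) in
theorem exists_ringHom (ι : A →+* B) (ζ : Bˣ) (h : ↑(ζ ^ n) = ι g) :
    ∃ f : S →+* B, f.comp (algebraMap A S) = ι ∧ f (algebraMap _ S (root g n)) = ζ := by
  let φ : CyclicCover g n →+* B :=
    Ideal.Quotient.lift (Ideal.span {X ^ n - C g}) (eval₂RingHom ι (ζ : B)) fun p hp ↦ by
      obtain ⟨q, rfl⟩ := Ideal.mem_span_singleton.mp hp
      simp [← h]
  have hφ : φ (root g n) = ζ := by simp [φ, root]
  refine ⟨IsLocalization.Away.lift (root g n) (g := φ) (hφ ▸ ζ.isUnit), ?_, by simp [hφ]⟩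
  rw [IsScalarTower.algebraMap_eq A (CyclicCover g n) S, ← RingHom.comp_assoc,
    IsLocalization.Away.lift_comp]
  ext a
  exact eval₂_C ι (ζ : B)

end

open LaurentPolynomial in
/-- After inverting the branch locus and adjoining one free unit, the cyclic cover of affine space
becomes isomorphic to affine space, provided that the degree of the weighted homogeneous branch
polynomial is coprime to the degree of the cover. -/
theorem nonempty_laurentPolynomial_ringEquiv {σ k : Type*} [CommRing k] {c : σ → ℕ}
    {g : MvPolynomial σ k} {n m : ℕ} (hg : g.IsWeightedHomogeneous c m) (hmn : m.Coprime n)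
    (S D : Type*) [CommRing S] [CommRing D]
    [Algebra (CyclicCover g n) S] [Algebra (MvPolynomial σ k) S]
    [IsScalarTower (MvPolynomial σ k) (CyclicCover g n) S] [IsLocalization.Away (root g n) S]
    [Algebra (MvPolynomial σ k) D] [IsLocalization.Away g D] :
    Nonempty (S[T;T⁻¹] ≃+* D[T;T⁻¹]) := by
  obtain ⟨α, γ, h⟩ : ∃ α γ : ℤ, n * α - m * γ = 1 := by
    obtain ⟨a, b, h⟩ := (Nat.isCoprime_iff_coprime.mpr hmn)
    exact ⟨b, -a, by linarith⟩
  let jS : MvPolynomial σ k →+* S[T;T⁻¹] := LaurentPolynomial.C.comp (algebraMap _ S)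
  let jD : MvPolynomial σ k →+* D[T;T⁻¹] := LaurentPolynomial.C.comp (algebraMap _ D)
  obtain ⟨t, ht⟩ : IsUnit (T 1 : S[T;T⁻¹]) := isUnit_T 1
  obtain ⟨w, hw⟩ : IsUnit (T 1 : D[T;T⁻¹]) := isUnit_T 1
  obtain ⟨z, hz⟩ := (IsLocalization.Away.algebraMap_isUnit (S := S) (root g n)).map
    (LaurentPolynomial.C : S →+* S[T;T⁻¹])
  obtain ⟨u, hu⟩ := (IsLocalization.Away.algebraMap_isUnit (S := D) g).map
    (LaurentPolynomial.C : D →+* D[T;T⁻¹])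
  -- the homomorphism from the left to the right
  set τ : D[T;T⁻¹]ˣ := u ^ γ * w ^ n with hτ
  set ζ : D[T;T⁻¹]ˣ := u ^ α * w ^ m with hζ
  obtain ⟨hτζ, hζu⟩ : τ ^ α * (ζ ^ γ)⁻¹ = w ∧ ζ ^ n = τ ^ m * u :=
    CommGroup.zpow_mul_pow_zpow_mul h u w
  obtain ⟨φ, hφA, hφz⟩ := exists_ringHom S (MvPolynomial.rescale c jD τ) ζ <| by
    rw [hg.rescale_apply, hζu, Units.val_mul, hu]; rfl
  let Φ : S[T;T⁻¹] →+* D[T;T⁻¹] := LaurentPolynomial.eval₂ φ τ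
  -- the homomorphism from the right to the left
  set υ : S[T;T⁻¹]ˣ := z ^ n * t⁻¹ ^ m with hυ
  set ω : S[T;T⁻¹]ˣ := t ^ α * (z ^ γ)⁻¹ with hω
  obtain ⟨ht', hz'⟩ := CommGroup.pow_zpow_mul_zpow_pow h t z
  have hυg : MvPolynomial.rescale c jS t⁻¹ g = υ := by
    rw [hg.rescale_apply, hυ, Units.val_mul, mul_comm, Units.val_pow_eq_pow_val z, hz, ← map_pow,
      algebraMap_root_pow]
    rfl
  let ψ : D →+* S[T;T⁻¹] := IsLocalization.Away.lift g (hυg ▸ υ.isUnit)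
  let Ψ : D[T;T⁻¹] →+* S[T;T⁻¹] := LaurentPolynomial.eval₂ ψ ω
  have hΦj (a) : Φ (jS a) = MvPolynomial.rescale c jD τ a := by
    simp [Φ, jS, ← hφA]
  have hΨj (a) : Ψ (jD a) = MvPolynomial.rescale c jS t⁻¹ a := by
    simp [Ψ, jD, ψ]
  have hΦt : Units.map Φ t = τ := by ext; simp [Φ, ht]
  have hΦz : Units.map Φ z = ζ := by ext; simp [Φ, hz, hφz]
  have hΨw : Units.map Ψ w = ω := by ext; simp [Ψ, hw]
  have hΨu : Units.map Ψ u = υ := by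
    ext; simp [Ψ, hu, ψ, hυg]
  have hΨτ : Units.map Ψ τ = t := by
    rw [hτ, map_mul, map_zpow, map_pow, hΨu, hΨw, ht']
  have hΨζ : Units.map Ψ ζ = z := by
    rw [hζ, map_mul, map_zpow, map_pow, hΨu, hΨw, hz']
  have hΦω : Units.map Φ ω = w := by
    rw [hω, map_mul, map_inv, map_zpow, map_zpow, hΦt, hΦz, hτζ]
  have hΨΦ : Ψ.comp Φ = RingHom.id _ := by
    refine LaurentPolynomial.ringHom_ext' (ringHom_ext (g := g) (n := n) ?_ ?_) ?_
    · refine MvPolynomial.ringHom_ext (fun a ↦ ?_) fun i ↦ ?_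
      · change Ψ (Φ (jS (.C a))) = jS (.C a)
        rw [hΦj, MvPolynomial.rescale_C, hΨj, MvPolynomial.rescale_C]
      · change Ψ (Φ (jS (.X i))) = jS (.X i)
        rw [hΦj, MvPolynomial.rescale_X, map_mul, hΨj, MvPolynomial.rescale_X,
          RingHom.apply_val_of_units_map_eq (f := Ψ) (y := t ^ c i) (by rw [map_pow, hΨτ]),
          inv_pow, Units.mul_inv_cancel_left]
    · change Ψ (Φ (LaurentPolynomial.C _)) = LaurentPolynomial.C _
      rw [← hz, RingHom.apply_val_of_units_map_eq hΦz, RingHom.apply_val_of_units_map_eq hΨζ]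
    · change Ψ (Φ _) = _
      rw [← ht, RingHom.apply_val_of_units_map_eq hΦt, RingHom.apply_val_of_units_map_eq hΨτ]
      rfl
  have hΦΨ : Φ.comp Ψ = RingHom.id _ := by
    refine LaurentPolynomial.ringHom_ext' (IsLocalization.ringHom_ext (Submonoid.powers g) ?_) ?_
    · refine MvPolynomial.ringHom_ext (fun a ↦ ?_) fun i ↦ ?_
      · change Φ (Ψ (jD (.C a))) = jD (.C a)
        rw [hΨj, MvPolynomial.rescale_C, hΦj, MvPolynomial.rescale_C]
      · change Φ (Ψ (jD (.X i))) = jD (.X i)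
        rw [hΨj, MvPolynomial.rescale_X, map_mul, hΦj, MvPolynomial.rescale_X,
          RingHom.apply_val_of_units_map_eq (f := Φ) (y := τ⁻¹ ^ c i)
            (by rw [map_pow, map_inv, hΦt]),
          inv_pow, Units.inv_mul_cancel_left]
    · change Φ (Ψ _) = _
      rw [← hw, RingHom.apply_val_of_units_map_eq hΨw, RingHom.apply_val_of_units_map_eq hΦω]
      rfl
  exact ⟨RingEquiv.ofRingHom Φ Ψ hΦΨ hΨΦ⟩

end CyclicCover

/-- Let `k` be a field and let `g ∈ k[x_1,…,x_d]` be an irreducible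
polynomial that is weighted homogeneous of degree `m` with respect to positive integer
weights `c_1,…,c_d`, with `m` relatively prime to `n`.  If the hypersurface ring
`R = k[z,x_1,…,x_d]/(zⁿ − g)` is a normal domain, then `R` is a unique factorization domain.
Here `k[z,x_1,…,x_d]` is realized as the polynomial ring in `z` over `k[x_1,…,x_d]`. -/
theorem divisor_class_stmt_5 {k : Type*} [Field k] {d n m : ℕ}
    (c : Fin d → ℕ) (hc : ∀ i, 0 < c i)
    (g : MvPolynomial (Fin d) k) (hirr : Irreducible g)
    (hwh : g.IsWeightedHomogeneous c m) (hmn : Nat.Coprime m n)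
    [IsDomain (Polynomial (MvPolynomial (Fin d) k) ⧸
      Ideal.span {Polynomial.X ^ n - Polynomial.C g})]
    [IsIntegrallyClosed (Polynomial (MvPolynomial (Fin d) k) ⧸
      Ideal.span {Polynomial.X ^ n - Polynomial.C g})] :
    UniqueFactorizationMonoid (Polynomial (MvPolynomial (Fin d) k) ⧸
      Ideal.span {Polynomial.X ^ n - Polynomial.C g}) := by
  have hf0 : (X ^ n - C g : (MvPolynomial (Fin d) k)[X]) ≠ 0 := by
    intro h
    have h1 : n = 0 := by
      by_contra hn
      have := congr_arg (coeff · n) h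
      simp [coeff_C, hn] at this
    subst h1
    rw [pow_zero, sub_eq_zero, ← C_1, C_inj] at h
    exact hirr.not_isUnit (h ▸ isUnit_one)
  have hf : Prime (X ^ n - C g : (MvPolynomial (Fin d) k)[X]) :=
    (Ideal.span_singleton_prime hf0).mp <|
      (Ideal.Quotient.isDomain_iff_prime _).mp ‹IsDomain (CyclicCover g n)›
  have hcoeff : Prime ((X ^ n - C g : (MvPolynomial (Fin d) k)[X]).coeff 0) := by
    rcases n.eq_zero_or_pos with rfl | hn
    · rwa [pow_zero, ← C_1, ← C_sub, coeff_C_zero, ← prime_C_iff, C_sub, C_1, ← pow_zero X]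
    · simpa [coeff_X_pow, hn.ne] using hirr.prime.neg
  have hz : Prime (CyclicCover.root g n) := prime_mk_X hf hcoeff
  let S := Localization.Away (CyclicCover.root g n)
  let D := Localization.Away g
  have : IsDomain S := IsLocalization.Away.isDomain S hz.ne_zero
  have : IsDomain D := IsLocalization.Away.isDomain D hirr.ne_zero
  have : IsNoetherianRing S := IsLocalization.isNoetherianRing (.powers (CyclicCover.root g n)) S
    inferInstance
  have : UniqueFactorizationMonoid D := .of_isLocalization (.powers g) D
  have : UniqueFactorizationMonoid D[T;T⁻¹] := .of_isLocalization (.powers (X : D[X])) _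
  obtain ⟨e⟩ := CyclicCover.nonempty_laurentPolynomial_ringEquiv hwh hmn S D
  have : UniqueFactorizationMonoid S[T;T⁻¹] :=
    e.symm.toMulEquiv.uniqueFactorizationMonoid inferInstance
  have : UniqueFactorizationMonoid S := .of_laurentPolynomial
  exact (UniqueFactorizationMonoid.iff_of_isLocalizationAway_of_prime hz S).mpr this
end

section
/- Let k be a field and let m_1, m_2, m_3, n be positive integers such that n is relatively prime to each m_i, and such that the characteristic of k is zero or does not divide any m_i. Then the hypersurface ring R = k[z,x_1,x_2,x_3]/(z^n − x_1^{m_1} − x_2^{m_2} − x_3^{m_3}) is a unique factorization domain. -/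
open Polynomial

/-- A ring homomorphism `φ : R → R[X]` encoding an `ℕ`-grading of `R`: the coefficient of `X ^ e`
in `φ r` is the homogeneous component of `r` of degree `e`. -/
structure IsGradingCoaction {R : Type*} [CommRing R] (φ : R →+* R[X]) : Prop where
  eval_one : ∀ r, (φ r).eval 1 = r
  map_coeff : ∀ r e, φ ((φ r).coeff e) = C ((φ r).coeff e) * X ^ e

/-- Homogeneity of an element with respect to a coaction `φ : R → R[X]`. -/
def IsCoactionHomogeneous {R : Type*} [CommRing R] (φ : R →+* R[X]) (r : R) : Prop :=
  ∃ e, φ r = C r * X ^ e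

namespace IsCoactionHomogeneous

variable {R : Type*} [CommRing R] {φ : R →+* R[X]}

theorem zero : IsCoactionHomogeneous φ 0 := ⟨0, by simp⟩

theorem one : IsCoactionHomogeneous φ 1 := ⟨0, by simp⟩

theorem mul {a b : R} (ha : IsCoactionHomogeneous φ a) (hb : IsCoactionHomogeneous φ b) :
    IsCoactionHomogeneous φ (a * b) := by
  obtain ⟨i, hi⟩ := ha
  obtain ⟨j, hj⟩ := hb
  exact ⟨i + j, by rw [map_mul, hi, hj, C_mul]; ring⟩

end IsCoactionHomogeneous

namespace IsGradingCoaction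

variable {R : Type*} [CommRing R] {φ : R →+* R[X]}

theorem injective (hφ : IsGradingCoaction φ) : Function.Injective φ := fun a b h => by
  rw [← hφ.eval_one a, h, hφ.eval_one]

theorem map_ne_zero (hφ : IsGradingCoaction φ) {r : R} (hr : r ≠ 0) : φ r ≠ 0 :=
  (map_ne_zero_iff φ hφ.injective).2 hr

theorem homogeneous_coeff (hφ : IsGradingCoaction φ) (r : R) (e : ℕ) :
    IsCoactionHomogeneous φ ((φ r).coeff e) := ⟨e, hφ.map_coeff r e⟩

/-- Divisibility of products by a homogeneous element only has to be tested on homogeneous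
elements. -/
theorem dvd_or_dvd_of_homogeneous (hφ : IsGradingCoaction φ) {p : R}
    (hp : IsCoactionHomogeneous φ p)
    (h : ∀ a b, IsCoactionHomogeneous φ a → IsCoactionHomogeneous φ b → p ∣ a * b →
      p ∣ a ∨ p ∣ b) {a b : R} (hab : p ∣ a * b) : p ∣ a ∨ p ∣ b := by
  let π := Ideal.Quotient.mk (Ideal.span {p})
  have hπ : ∀ r, π r = 0 ↔ p ∣ r := fun r => by
    rw [Ideal.Quotient.eq_zero_iff_mem, Ideal.mem_span_singleton]
  have hker : ∀ r, (φ r).map π = 0 ↔ p ∣ r := by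
    refine fun r => ⟨fun hr => ?_, ?_⟩
    · have h1 : ((φ r).map π).eval 1 = π r := by
        rw [← map_one π, eval_map_apply, hφ.eval_one]
      rw [← hπ, ← h1, hr, eval_zero]
    · rintro ⟨q, rfl⟩
      obtain ⟨e, he⟩ := hp
      simp [he, (hπ p).2 dvd_rfl]
  by_contra! hcon
  have hlc : ∀ r, ¬ p ∣ r → ∃ e, ((φ r).map π).leadingCoeff = π ((φ r).coeff e) ∧
      ¬ p ∣ (φ r).coeff e := fun r hr => by
    refine ⟨((φ r).map π).natDegree, by rw [leadingCoeff, coeff_map], ?_⟩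
    rw [← hπ, ← coeff_map]
    exact leadingCoeff_ne_zero.2 (mt (hker r).1 hr)
  obtain ⟨i, hi, hi'⟩ := hlc a hcon.1
  obtain ⟨j, hj, hj'⟩ := hlc b hcon.2
  have hne : ((φ a).map π).leadingCoeff * ((φ b).map π).leadingCoeff ≠ 0 := by
    rw [hi, hj, ← map_mul, Ne, hπ]
    exact fun hd => (h _ _ (hφ.homogeneous_coeff a i) (hφ.homogeneous_coeff b j) hd).elim hi' hj'
  rw [← leadingCoeff_mul' hne, Ne, leadingCoeff_eq_zero, ← Polynomial.map_mul, ← map_mul,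
    hker] at hne
  exact hne hab

theorem noZeroDivisors (hφ : IsGradingCoaction φ)
    (h : ∀ a b, IsCoactionHomogeneous φ a → IsCoactionHomogeneous φ b → a * b = 0 →
      a = 0 ∨ b = 0) : NoZeroDivisors R where
  eq_zero_or_eq_zero_of_mul_eq_zero {a b} hab := by
    simpa only [zero_dvd_iff] using hφ.dvd_or_dvd_of_homogeneous (p := 0)
      IsCoactionHomogeneous.zero (by simpa only [zero_dvd_iff] using h) (zero_dvd_iff.2 hab)

theorem homogeneous_iff (hφ : IsGradingCoaction φ) {r : R} :
    IsCoactionHomogeneous φ r ↔ (φ r).natDegree ≤ (φ r).natTrailingDegree := by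
  constructor
  · rintro ⟨e, he⟩
    rcases eq_or_ne r 0 with rfl | hr
    · simp
    · rw [he, natDegree_C_mul_X_pow _ _ hr, C_mul_X_pow_eq_monomial, natTrailingDegree_monomial hr]
  · intro h
    have h1 : φ r = C ((φ r).coeff (φ r).natDegree) * X ^ (φ r).natDegree := by
      ext m
      rw [coeff_C_mul_X_pow]
      split_ifs with hm
      · rw [hm]
      · rcases lt_or_gt_of_ne hm with hlt | hgt
        · exact coeff_eq_zero_of_lt_natTrailingDegree (hlt.trans_le h)
        · exact coeff_eq_zero_of_natDegree_lt hgt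
    have h2 : r = (φ r).coeff (φ r).natDegree := by
      conv_lhs => rw [← hφ.eval_one r, h1]
      simp
    rw [← h2] at h1
    exact ⟨_, h1⟩

variable [IsDomain R]

/-- In a graded domain, factors of nonzero homogeneous elements are homogeneous. -/
theorem homogeneous_of_dvd (hφ : IsGradingCoaction φ) {a b : R} (hb : b ≠ 0)
    (hbh : IsCoactionHomogeneous φ b) (hab : a ∣ b) : IsCoactionHomogeneous φ a := by
  obtain ⟨c, rfl⟩ := hab
  have ha := hφ.map_ne_zero (left_ne_zero_of_mul hb)
  have hc := hφ.map_ne_zero (right_ne_zero_of_mul hb)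
  rw [hφ.homogeneous_iff, map_mul, natDegree_mul ha hc, natTrailingDegree_mul ha hc] at hbh
  rw [hφ.homogeneous_iff]
  have := natTrailingDegree_le_natDegree (φ c)
  omega

/-- If `f` has no homogeneous prime factor, then homogeneous factors may be cancelled in
divisibilities by `f`. -/
theorem dvd_of_dvd_homogeneous_mul [WfDvdMonoid R] (hφ : IsGradingCoaction φ)
    (hprime : ∀ h, IsCoactionHomogeneous φ h → h ≠ 0 → ¬ IsUnit h →
      ∃ p, IsCoactionHomogeneous φ p ∧ Prime p ∧ p ∣ h)
    {f : R} (hf : ∀ p, IsCoactionHomogeneous φ p → Prime p → ¬ p ∣ f) (h : R) :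
    IsCoactionHomogeneous φ h → h ≠ 0 → ∀ g, f ∣ h * g → f ∣ g := by
  induction h using (wellFounded_dvdNotUnit (α := R)).induction with
  | _ h ih =>
    intro hh h0 g hg
    by_cases hu : IsUnit h
    · exact (hu.dvd_mul_left).1 hg
    obtain ⟨p, hp, hpp, h', rfl⟩ := hprime h hh h0 hu
    have h'0 := right_ne_zero_of_mul h0
    refine ih h' ⟨h'0, p, hpp.not_isUnit, mul_comm _ _⟩
      (hφ.homogeneous_of_dvd h0 hh (dvd_mul_left _ _)) h'0 g ?_
    obtain ⟨q, hq⟩ := hg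
    have hpq : p ∣ q :=
      (hpp.dvd_or_dvd ⟨h' * g, by rw [← hq, mul_assoc]⟩).resolve_left (hf p hp hpp)
    obtain ⟨q', rfl⟩ := hpq
    exact ⟨q', mul_left_cancel₀ hpp.ne_zero (by linear_combination hq)⟩

/-- The difference between the largest and the smallest degree of the homogeneous components. -/
noncomputable def width (φ : R →+* R[X]) (r : R) : ℕ :=
  (φ r).natDegree - (φ r).natTrailingDegree

theorem width_le_of_dvd (hφ : IsGradingCoaction φ) {a b : R} (hb : b ≠ 0) (hab : a ∣ b) :
    width φ a ≤ width φ b := by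
  obtain ⟨c, rfl⟩ := hab
  have ha := hφ.map_ne_zero (left_ne_zero_of_mul hb)
  have hc := hφ.map_ne_zero (right_ne_zero_of_mul hb)
  rw [width, width, map_mul, natDegree_mul ha hc, natTrailingDegree_mul ha hc]
  have := natTrailingDegree_le_natDegree (φ c)
  omega

/-- One step of division by `f` after multiplication with a homogeneous element. -/
theorem exists_width_lt (hφ : IsGradingCoaction φ) {f g : R} (hf : f ≠ 0) (hg : g ≠ 0)
    (hfg : width φ f ≤ width φ g) :
    ∃ h q, IsCoactionHomogeneous φ h ∧ h ≠ 0 ∧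
      (h * g - q * f = 0 ∨ width φ (h * g - q * f) < width φ g) := by
  have hf' := hφ.map_ne_zero hf
  have hg' := hφ.map_ne_zero hg
  have hlf := leadingCoeff_ne_zero.2 hf'
  have hlg := leadingCoeff_ne_zero.2 hg'
  refine ⟨(φ f).leadingCoeff, (φ g).leadingCoeff, hφ.homogeneous_coeff _ _, hlf, ?_⟩
  rw [or_iff_not_imp_left]
  intro hne
  set b := (φ f).natDegree with hb
  set e := (φ g).natDegree with he
  have h1 : φ ((φ f).leadingCoeff * g - (φ g).leadingCoeff * f) =
      C (φ f).leadingCoeff * X ^ b * φ g - C (φ g).leadingCoeff * X ^ e * φ f := by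
    rw [map_sub, map_mul, map_mul, leadingCoeff, leadingCoeff, hφ.map_coeff, hφ.map_coeff]
  have hne' := hφ.map_ne_zero hne
  have hm1 : C (φ f).leadingCoeff * X ^ b ≠ 0 := by simpa using hf'
  have hm2 : C (φ g).leadingCoeff * X ^ e ≠ 0 := by simpa using hg'
  have hd1 : (C (φ f).leadingCoeff * X ^ b * φ g).natDegree = b + e := by
    rw [natDegree_mul hm1 hg', natDegree_C_mul_X_pow _ _ hlf]
  have hd2 : (C (φ g).leadingCoeff * X ^ e * φ f).natDegree = e + b := by
    rw [natDegree_mul hm2 hf', natDegree_C_mul_X_pow _ _ hlg]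
  have htop : (φ ((φ f).leadingCoeff * g - (φ g).leadingCoeff * f)).natDegree < b + e := by
    rw [← hd1]
    refine natDegree_lt_natDegree hne' ?_
    rw [h1]
    refine degree_sub_lt_left ?_ (mul_ne_zero hm1 hg') ?_
    · rw [degree_eq_natDegree (mul_ne_zero hm1 hg'), degree_eq_natDegree (mul_ne_zero hm2 hf'),
        hd1, hd2, add_comm]
    · simp [mul_comm]
  have hfe := natTrailingDegree_le_natDegree (φ f)
  have hge := natTrailingDegree_le_natDegree (φ g)
  unfold width at hfg ⊢
  have hbot : b + (φ g).natTrailingDegree ≤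
      (φ ((φ f).leadingCoeff * g - (φ g).leadingCoeff * f)).natTrailingDegree := by
    refine le_natTrailingDegree hne' fun m hm => ?_
    rw [h1, coeff_sub, mul_assoc, mul_assoc, coeff_C_mul, coeff_C_mul, coeff_X_pow_mul',
      coeff_X_pow_mul']
    have z1 : b ≤ m → (φ g).coeff (m - b) = 0 := fun _ =>
      coeff_eq_zero_of_lt_natTrailingDegree (by omega)
    have z2 : e ≤ m → (φ f).coeff (m - e) = 0 := fun _ =>
      coeff_eq_zero_of_lt_natTrailingDegree (by omega)
    split_ifs <;> simp_all
  have := natTrailingDegree_le_natDegree (φ ((φ f).leadingCoeff * g - (φ g).leadingCoeff * f))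
  omega

/-- If `f` has minimal width in an ideal, then it divides a homogeneous multiple of every element of
the ideal. -/
theorem exists_homogeneous_dvd_mul (hφ : IsGradingCoaction φ) {I : Ideal R} {f : R} (hfI : f ∈ I)
    (hf : f ≠ 0) (hmin : ∀ g ∈ I, g ≠ 0 → width φ f ≤ width φ g) {g : R} (hg : g ∈ I) :
    ∃ h, IsCoactionHomogeneous φ h ∧ h ≠ 0 ∧ f ∣ h * g := by
  induction hw : width φ g using Nat.strong_induction_on generalizing g with
  | _ w ih =>
    rcases eq_or_ne g 0 with rfl | hg0
    · exact ⟨1, .one, one_ne_zero, by simp⟩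
    obtain ⟨h, q, hh, hh0, hlt⟩ := hφ.exists_width_lt hf hg0 (hmin g hg hg0)
    have key : ∃ h', IsCoactionHomogeneous φ h' ∧ h' ≠ 0 ∧ f ∣ h' * (h * g - q * f) := by
      rcases hlt with h0 | hlt
      · exact ⟨1, .one, one_ne_zero, by simp [h0]⟩
      · exact ih _ (hw ▸ hlt) (I.sub_mem (I.mul_mem_left _ hg) (I.mul_mem_left _ hfI)) rfl
    obtain ⟨h', hh', hh'0, hd⟩ := key
    refine ⟨h' * h, hh'.mul hh, mul_ne_zero hh'0 hh0, ?_⟩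
    have := dvd_add hd (dvd_mul_left f (h' * q))
    convert this using 1
    ring

theorem exists_prime_mem_of_homogeneous_mem [WfDvdMonoid R] (hφ : IsGradingCoaction φ)
    (hprime : ∀ h, IsCoactionHomogeneous φ h → h ≠ 0 → ¬ IsUnit h →
      ∃ p, IsCoactionHomogeneous φ p ∧ Prime p ∧ p ∣ h)
    {P : Ideal R} (hP : P.IsPrime) (h : R) :
    IsCoactionHomogeneous φ h → h ≠ 0 → h ∈ P → ∃ p ∈ P, Prime p := by
  induction h using (wellFounded_dvdNotUnit (α := R)).induction with
  | _ h ih =>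
    intro hh h0 hhP
    obtain ⟨p, hp, hpp, h', rfl⟩ := hprime h hh h0
      fun hu => hP.ne_top (Ideal.eq_top_of_isUnit_mem _ hhP hu)
    rcases hP.mem_or_mem hhP with hpP | hP'
    · exact ⟨p, hpP, hpp⟩
    · have h'0 := right_ne_zero_of_mul h0
      exact ih h' ⟨h'0, p, hpp.not_isUnit, mul_comm _ _⟩
        (hφ.homogeneous_of_dvd h0 hh (dvd_mul_left _ _)) h'0 hP'

/-- A graded domain satisfying the ascending chain condition on principal ideals, in which every
homogeneous nonzero nonunit has a homogeneous prime factor, is a unique factorization domain. -/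
theorem uniqueFactorizationMonoid [WfDvdMonoid R] (hφ : IsGradingCoaction φ)
    (hprime : ∀ h, IsCoactionHomogeneous φ h → h ≠ 0 → ¬ IsUnit h →
      ∃ p, IsCoactionHomogeneous φ p ∧ Prime p ∧ p ∣ h) :
    UniqueFactorizationMonoid R := by
  rw [UniqueFactorizationMonoid.iff_exists_prime_mem_of_isPrime]
  intro P hPbot hP
  by_cases hhom : ∃ h ∈ P, IsCoactionHomogeneous φ h ∧ h ≠ 0
  · obtain ⟨h, hhP, hh, h0⟩ := hhom
    exact hφ.exists_prime_mem_of_homogeneous_mem hprime hP h hh h0 hhP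
  push Not at hhom
  obtain ⟨f₀, hf₀P, hf₀⟩ := P.ne_bot_iff.1 hPbot
  obtain ⟨f₁, ⟨hf₁P, hf₁⟩, hmin₁⟩ := WellFounded.has_min (measure (width φ)).wf
    {f | f ∈ P ∧ f ≠ 0} ⟨f₀, hf₀P, hf₀⟩
  obtain ⟨f, ⟨hfP, hf, hff₁⟩, hmin⟩ := WellFounded.has_min (wellFounded_dvdNotUnit (α := R))
    {f | f ∈ P ∧ f ≠ 0 ∧ f ∣ f₁} ⟨f₁, hf₁P, hf₁, dvd_rfl⟩
  have hnd : ∀ p, IsCoactionHomogeneous φ p → Prime p → ¬ p ∣ f := by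
    rintro p hp hpp ⟨f', rfl⟩
    have hf' := right_ne_zero_of_mul hf
    have hpP : p ∉ P := fun hpP => hpp.ne_zero (hhom p hpP hp)
    exact hmin f' ⟨(hP.mem_or_mem hfP).resolve_left hpP, hf', (dvd_mul_left _ _).trans hff₁⟩
      ⟨hf', p, hpp.not_isUnit, mul_comm _ _⟩
  have hdvd : ∀ g ∈ P, f ∣ g := by
    intro g hg
    obtain ⟨h, hh, h0, hd⟩ := hφ.exists_homogeneous_dvd_mul hfP hf (fun g' hg' hg'0 =>
      (hφ.width_le_of_dvd hf₁ hff₁).trans (not_lt.1 (hmin₁ g' ⟨hg', hg'0⟩))) hg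
    exact hφ.dvd_of_dvd_homogeneous_mul hprime hnd h hh h0 g hd
  refine ⟨f, hfP, hf, fun hu => hP.ne_top (Ideal.eq_top_of_isUnit_mem _ hfP hu), ?_⟩
  exact fun a b hab => (hP.mem_or_mem (P.mem_of_dvd hab hfP)).imp (hdvd a) (hdvd b)

end IsGradingCoaction

/-- The ring `A[z] / (z ^ n - F)` obtained from `A` by adjoining an `n`-th root of `F`. -/
abbrev RootExtension {A : Type*} [CommRing A] (F : A) (n : ℕ) : Type _ :=
  A[X] ⧸ Ideal.span {(X ^ n - C F : A[X])}

namespace RootExtension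

variable {A : Type*} [CommRing A] (F : A) (n : ℕ)

/-- The structure map of `A[z] / (z ^ n - F)`. -/
noncomputable def ofBase : A →+* RootExtension F n := (Ideal.Quotient.mk _).comp C

/-- The adjoined `n`-th root. -/
noncomputable def root : RootExtension F n := Ideal.Quotient.mk _ X

theorem root_pow : root F n ^ n = ofBase F n F := by
  rw [root, ofBase, RingHom.comp_apply, ← map_pow, Ideal.Quotient.eq]
  exact Ideal.mem_span_singleton_self _

theorem induction_on {motive : RootExtension F n → Prop} (r : RootExtension F n)
    (add : ∀ r s, motive r → motive s → motive (r + s))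
    (mul_pow : ∀ a j, motive (ofBase F n a * root F n ^ j)) : motive r := by
  obtain ⟨p, rfl⟩ := Ideal.Quotient.mk_surjective r
  induction p using Polynomial.induction_on' with
  | add p q hp hq => rw [map_add]; exact add _ _ hp hq
  | monomial j a =>
    rw [← C_mul_X_pow_eq_monomial, map_mul, map_pow]
    exact mul_pow a j

variable {F n}

theorem dvd_of_ofBase_dvd (hn : n ≠ 0) {a b : A} (h : ofBase F n a ∣ ofBase F n b) : a ∣ b := by
  nontriviality A
  obtain ⟨r, hr⟩ := h
  obtain ⟨p, rfl⟩ := Ideal.Quotient.mk_surjective r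
  have hmonic := monic_X_pow_sub_C F hn
  have hlt : (C b : A[X]).degree < (X ^ n - C F : A[X]).degree := by
    rw [degree_X_pow_sub_C (Nat.pos_of_ne_zero hn)]
    exact degree_C_le.trans_lt (by exact_mod_cast Nat.pos_of_ne_zero hn)
  have h1 : (X ^ n - C F : A[X]) ∣ C b - C a * p := by
    rw [← Ideal.mem_span_singleton, ← Ideal.Quotient.eq, map_mul]
    exact hr
  have h2 : C b - C a * (p %ₘ (X ^ n - C F)) = 0 := by
    rw [← modByMonic_eq_zero_iff_dvd hmonic, sub_modByMonic,
      (modByMonic_eq_self_iff hmonic).2 hlt, ← smul_eq_C_mul, smul_modByMonic] at h1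
    rwa [← smul_eq_C_mul]
  refine ⟨(p %ₘ (X ^ n - C F)).coeff 0, ?_⟩
  have := congrArg (coeff · 0) h2
  simpa [sub_eq_zero] using this

theorem ofBase_dvd_iff (hn : n ≠ 0) {a b : A} : ofBase F n a ∣ ofBase F n b ↔ a ∣ b :=
  ⟨dvd_of_ofBase_dvd hn, _root_.map_dvd _⟩

theorem ofBase_eq_zero_iff (hn : n ≠ 0) {a : A} : ofBase F n a = 0 ↔ a = 0 := by
  rw [← zero_dvd_iff, ← map_zero (ofBase F n), ofBase_dvd_iff hn, zero_dvd_iff]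

theorem ofBase_dvd_of_dvd_mul_root_pow (hn : n ≠ 0) {a b : A} {j : ℕ}
    (h : ofBase F n a ∣ ofBase F n b * root F n ^ j) : a ∣ b * F ^ j := by
  rw [← ofBase_dvd_iff (F := F) hn, map_mul, map_pow, ← root_pow, ← pow_mul, mul_comm n j]
  obtain ⟨k, hk⟩ := Nat.exists_eq_add_of_le (Nat.le_mul_of_pos_right j (Nat.pos_of_ne_zero hn))
  rw [hk, pow_add, ← mul_assoc]
  exact h.mul_right _

theorem root_dvd_ofBase_iff (hn : n ≠ 0) {b : A} : root F n ∣ ofBase F n b ↔ F ∣ b := by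
  constructor
  · rintro ⟨r, hr⟩
    have hev : ∀ p ∈ Ideal.span {(X ^ n - C F : A[X])},
        ((Ideal.Quotient.mk (Ideal.span {F})).comp (evalRingHom 0)) p = 0 := by
      intro p hp
      obtain ⟨q, rfl⟩ := Ideal.mem_span_singleton.1 hp
      simp [hn]
    have := congrArg (Ideal.Quotient.lift _ _ hev) hr
    rw [map_mul] at this
    simp only [ofBase, root, RingHom.comp_apply, Ideal.Quotient.lift_mk] at this
    simpa [Ideal.Quotient.eq_zero_iff_mem, Ideal.mem_span_singleton] using this
  · intro h
    refine dvd_trans ?_ (_root_.map_dvd (ofBase F n) h)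
    rw [← root_pow]
    exact dvd_pow_self _ hn

variable {δ : A →+* A[X]} {d : ℕ}

/-- The coaction on `A[z] / (z ^ n - F)` for which the degrees of elements of `A` are multiplied
by `n` and `z` has degree `d`, where `d` is the degree of `F`. -/
noncomputable def coaction (n : ℕ) (hF : δ F = C F * X ^ d) :
    RootExtension F n →+* (RootExtension F n)[X] :=
  Ideal.Quotient.lift _
    (eval₂RingHom ((mapRingHom (ofBase F n)).comp ((expand A n : A[X] →+* A[X]).comp δ))
      (C (root F n) * X ^ d)) (by
    intro p hp
    obtain ⟨q, rfl⟩ := Ideal.mem_span_singleton.1 hp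
    rw [map_mul]
    convert! zero_mul _
    simp only [coe_eval₂RingHom, eval₂_sub, eval₂_X_pow, eval₂_C, RingHom.comp_apply, hF]
    simp only [RingHom.coe_coe, map_mul, map_pow, expand_C, expand_X, coe_mapRingHom, map_C, map_X]
    rw [C_mul_X_pow_eq_monomial, monomial_pow, root_pow, ← pow_mul, C_mul_X_pow_eq_monomial,
      mul_comm d n, sub_self])

variable {hF : δ F = C F * X ^ d}

theorem coaction_ofBase (a : A) :
    coaction n hF (ofBase F n a) = (expand A n (δ a)).map (ofBase F n) := by
  simp [coaction, ofBase]

theorem coaction_root : coaction n hF (root F n) = C (root F n) * X ^ d := by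
  simp [coaction, root]

theorem coaction_ofBase_mul_root_pow (a : A) (j : ℕ) :
    coaction n hF (ofBase F n a * root F n ^ j) =
      (expand A n (δ a)).map (ofBase F n) * C (root F n ^ j) * X ^ (d * j) := by
  rw [map_mul, map_pow, coaction_ofBase, coaction_root, C_mul_X_pow_eq_monomial,
    monomial_pow, mul_assoc, C_mul_X_pow_eq_monomial]

/-- Every homogeneous component is the product of a homogeneous element of the base
ring with a power of the root. -/
theorem coeff_coaction (hδ : IsGradingCoaction δ) (hn : n ≠ 0) (hnd : n.Coprime d)
    (r : RootExtension F n) (e : ℕ) :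
    ∃ b m j, (coaction n hF r).coeff e = ofBase F n b * root F n ^ j ∧
      δ b = C b * X ^ m ∧ (b = 0 ∨ n * m + d * j = e) := by
  have key : ∀ (b b' : A) (m m' j i : ℕ), δ b = C b * X ^ m → δ b' = C b' * X ^ m' →
      n * m + d * (j + i) = e → n * m' + d * j = e →
      ∃ c m'' j', ofBase F n b * root F n ^ (j + i) + ofBase F n b' * root F n ^ j =
        ofBase F n c * root F n ^ j' ∧ δ c = C c * X ^ m'' ∧ (c = 0 ∨ n * m'' + d * j' = e) := by
    intro b b' m m' j i hb hb' h1 h2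
    have hdi : n ∣ d * i := by
      refine (Nat.dvd_add_right (dvd_mul_right n m)).1 ⟨m', ?_⟩
      linarith
    obtain ⟨q, rfl⟩ := hnd.dvd_of_dvd_mul_left hdi
    have hm' : m' = m + d * q := by
      apply Nat.eq_of_mul_eq_mul_left (Nat.pos_of_ne_zero hn)
      linarith
    refine ⟨F ^ q * b + b', m', j, ?_, ?_, Or.inr h2⟩
    · rw [pow_add, pow_mul, root_pow, map_add, map_mul, map_pow]
      ring
    · rw [map_add, map_mul, map_pow, hF, hb, hb', hm', C_add, C_mul, C_pow]
      ring
  induction r using RootExtension.induction_on with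
  | add r s hr hs =>
    obtain ⟨b, m, j, h1, h2, h3⟩ := hr
    obtain ⟨b', m', j', h1', h2', h3'⟩ := hs
    rw [map_add, coeff_add, h1, h1']
    rcases h3 with rfl | h3
    · exact ⟨b', m', j', by simp, h2', h3'⟩
    rcases h3' with rfl | h3'
    · exact ⟨b, m, j, by simp, h2, Or.inr h3⟩
    rcases le_total j' j with h | h
    · obtain ⟨i, rfl⟩ := Nat.exists_eq_add_of_le h
      exact key b b' m m' j' i h2 h2' h3 h3'
    · obtain ⟨i, rfl⟩ := Nat.exists_eq_add_of_le h
      rw [add_comm]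
      exact key b' b m' m j i h2' h2 h3' h3
  | mul_pow a j =>
    rw [coaction_ofBase_mul_root_pow, coeff_mul_X_pow']
    split_ifs with h
    · rw [coeff_mul_C, coeff_map, coeff_expand (Nat.pos_of_ne_zero hn)]
      split_ifs with h'
      · refine ⟨_, _, j, rfl, hδ.map_coeff a _, Or.inr ?_⟩
        rw [Nat.mul_div_cancel' h']
        omega
      · exact ⟨0, 0, 0, by simp, by simp, Or.inl rfl⟩
    · exact ⟨0, 0, 0, by simp, by simp, Or.inl rfl⟩

theorem isGradingCoaction_coaction (hδ : IsGradingCoaction δ) (hn : n ≠ 0) (hnd : n.Coprime d) :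
    IsGradingCoaction (coaction n hF) where
  eval_one r := by
    induction r using RootExtension.induction_on with
    | add r s hr hs => rw [map_add, eval_add, hr, hs]
    | mul_pow a j =>
      rw [coaction_ofBase_mul_root_pow]
      have : ((expand A n (δ a)).map (ofBase F n)).eval 1 = ofBase F n a := by
        rw [← map_one (ofBase F n), eval_map_apply, expand_eval, one_pow, hδ.eval_one]
      simp [this]
  map_coeff r e := by
    obtain ⟨b, m, j, h1, h2, h3⟩ := coeff_coaction (hF := hF) hδ hn hnd r e
    rw [h1, coaction_ofBase_mul_root_pow]
    rcases h3 with rfl | rfl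
    · simp
    · simp only [h2, map_mul, map_pow, expand_C, expand_X, Polynomial.map_mul, map_C,
        Polynomial.map_pow, map_X]
      ring

theorem exists_eq_of_homogeneous (hδ : IsGradingCoaction δ) (hn : n ≠ 0) (hnd : n.Coprime d)
    {r : RootExtension F n} (hr : IsCoactionHomogeneous (coaction n hF) r) :
    ∃ b j, r = ofBase F n b * root F n ^ j := by
  obtain ⟨e, he⟩ := hr
  obtain ⟨b, m, j, h, -⟩ := coeff_coaction (hF := hF) hδ hn hnd r e
  exact ⟨b, j, by simpa [he] using h⟩

theorem root_ne_zero (hF0 : F ≠ 0) (hn : n ≠ 0) : root F n ≠ 0 := fun h => by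
  have := root_pow F n
  rw [h, zero_pow hn] at this
  exact hF0 ((ofBase_eq_zero_iff hn).1 this.symm)

theorem isDomain [IsDomain A] (hδ : IsGradingCoaction δ) (hF : δ F = C F * X ^ d)
    (hF0 : F ≠ 0) (hn : n ≠ 0) (hnd : n.Coprime d) : IsDomain (RootExtension F n) := by
  have hφ := isGradingCoaction_coaction (hF := hF) hδ hn hnd
  have : NoZeroDivisors (RootExtension F n) := by
    refine hφ.noZeroDivisors fun a b ha hb hab => ?_
    obtain ⟨a, i, rfl⟩ := exists_eq_of_homogeneous hδ hn hnd ha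
    obtain ⟨b, j, rfl⟩ := exists_eq_of_homogeneous hδ hn hnd hb
    have h0 : a * b * F ^ (i + j) = 0 := by
      rw [← zero_dvd_iff]
      refine ofBase_dvd_of_dvd_mul_root_pow (F := F) hn ?_
      rw [map_zero, zero_dvd_iff, ← hab, map_mul]
      ring
    rcases mul_eq_zero.1 ((mul_eq_zero.1 h0).resolve_right (pow_ne_zero _ hF0)) with rfl | rfl
    · simp
    · simp
  have : Nontrivial (RootExtension F n) :=
    ⟨⟨ofBase F n 1, 0, fun h => one_ne_zero ((ofBase_eq_zero_iff hn).1 h)⟩⟩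
  exact NoZeroDivisors.to_isDomain _

theorem prime_root (hδ : IsGradingCoaction δ) (hF : δ F = C F * X ^ d) (hFp : Prime F)
    (hn : n ≠ 0) (hnd : n.Coprime d) : Prime (root F n) := by
  have hφ := isGradingCoaction_coaction (hF := hF) hδ hn hnd
  refine ⟨root_ne_zero hFp.ne_zero hn, fun hu => hFp.not_isUnit ?_, fun a b hab => ?_⟩
  · rw [isUnit_iff_dvd_one, ← root_dvd_ofBase_iff hn, map_one]
    exact hu.dvd
  refine hφ.dvd_or_dvd_of_homogeneous ⟨d, coaction_root⟩ (fun a b ha hb hab => ?_) hab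
  obtain ⟨a, i, rfl⟩ := exists_eq_of_homogeneous hδ hn hnd ha
  obtain ⟨b, j, rfl⟩ := exists_eq_of_homogeneous hδ hn hnd hb
  rcases Nat.eq_zero_or_pos i with rfl | hi
  · rcases Nat.eq_zero_or_pos j with rfl | hj
    · simp only [pow_zero, mul_one, ← map_mul, root_dvd_ofBase_iff hn] at hab ⊢
      exact hFp.dvd_or_dvd hab
    · exact Or.inr ((dvd_pow_self _ hj.ne').mul_left _)
  · exact Or.inl ((dvd_pow_self _ hi.ne').mul_left _)

theorem prime_ofBase (hδ : IsGradingCoaction δ) (hn : n ≠ 0) (hnd : n.Coprime d) {p : A}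
    (hp : Prime p) (hph : IsCoactionHomogeneous (coaction n hF) (ofBase F n p)) (hpF : ¬ p ∣ F) :
    Prime (ofBase F n p) := by
  have hφ := isGradingCoaction_coaction (hF := hF) hδ hn hnd
  refine ⟨mt (ofBase_eq_zero_iff hn).1 hp.ne_zero, fun hu => hp.not_isUnit ?_, fun a b hab => ?_⟩
  · rw [isUnit_iff_dvd_one, ← ofBase_dvd_iff (F := F) hn, map_one]
    exact hu.dvd
  refine hφ.dvd_or_dvd_of_homogeneous hph (fun a b ha hb hab => ?_) hab
  obtain ⟨a, i, rfl⟩ := exists_eq_of_homogeneous hδ hn hnd ha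
  obtain ⟨b, j, rfl⟩ := exists_eq_of_homogeneous hδ hn hnd hb
  have h : p ∣ a * b * F ^ (i + j) := by
    refine ofBase_dvd_of_dvd_mul_root_pow hn (hab.trans (dvd_of_eq ?_))
    rw [map_mul]
    ring
  refine (hp.dvd_or_dvd ((hp.dvd_or_dvd h).resolve_right (mt hp.dvd_of_dvd_pow hpF))).imp ?_ ?_
  · exact fun h => (_root_.map_dvd _ h).mul_right _
  · exact fun h => (_root_.map_dvd _ h).mul_right _

/-- Adjoining an `n`-th root of a homogeneous prime element of degree coprime to `n` to a
Noetherian graded unique factorization domain gives a unique factorization domain. -/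
theorem uniqueFactorizationMonoid [IsDomain A] [IsNoetherianRing A] [UniqueFactorizationMonoid A]
    [IsDomain (RootExtension F n)] (hδ : IsGradingCoaction δ) (hF : δ F = C F * X ^ d)
    (hFp : Prime F) (hn : n ≠ 0) (hnd : n.Coprime d) :
    UniqueFactorizationMonoid (RootExtension F n) := by
  have hφ := isGradingCoaction_coaction (hF := hF) hδ hn hnd
  have hz : ∀ h : RootExtension F n, root F n ∣ h →
      ∃ p, IsCoactionHomogeneous (coaction n hF) p ∧ Prime p ∧ p ∣ h := fun h hd =>
    ⟨root F n, ⟨d, coaction_root⟩, prime_root hδ hF hFp hn hnd, hd⟩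
  refine hφ.uniqueFactorizationMonoid fun h hh h0 hu => ?_
  obtain ⟨b, j, rfl⟩ := exists_eq_of_homogeneous hδ hn hnd hh
  rcases Nat.eq_zero_or_pos j with rfl | hj
  · rw [pow_zero, mul_one] at hh h0 hu ⊢
    obtain ⟨p, hp, hpb⟩ := WfDvdMonoid.exists_irreducible_factor
      (fun hb => hu (hb.map (ofBase F n))) (mt (ofBase_eq_zero_iff hn).2 h0)
    replace hp := hp.prime
    by_cases hpF : p ∣ F
    · exact hz _ ((root_dvd_ofBase_iff hn).2
        (((hp.associated_of_dvd hFp hpF).symm.dvd).trans hpb))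
    · have hph := hφ.homogeneous_of_dvd h0 hh (_root_.map_dvd _ hpb)
      exact ⟨_, hph, prime_ofBase hδ hn hnd hp hph hpF, _root_.map_dvd _ hpb⟩
  · exact hz _ ((dvd_pow_self _ hj.ne').mul_left _)

end RootExtension

namespace MvPolynomial

/-- The coaction encoding the grading of a polynomial ring with weights `w`. -/
noncomputable def weightCoaction (k : Type*) [CommRing k] {σ : Type*} (w : σ → ℕ) :
    MvPolynomial σ k →+* (MvPolynomial σ k)[X] :=
  eval₂Hom (Polynomial.C.comp C) fun i => Polynomial.C (X i) * Polynomial.X ^ w i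

variable {k : Type*}

theorem isGradingCoaction_weightCoaction [CommRing k] {σ : Type*} (w : σ → ℕ) :
    IsGradingCoaction (weightCoaction k w) where
  eval_one r := by
    induction r using MvPolynomial.induction_on with
    | C a => simp [weightCoaction]
    | add p q hp hq => rw [map_add, Polynomial.eval_add, hp, hq]
    | mul_X p i hp => simp [weightCoaction] at hp ⊢; rw [hp]
  map_coeff r := by
    induction r using MvPolynomial.induction_on with
    | C a =>
      intro e
      rcases eq_or_ne e 0 with rfl | he
      · simp [weightCoaction]
      · simp [weightCoaction, Polynomial.coeff_C_of_ne_zero he]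
    | add p q hp hq =>
      intro e
      rw [map_add, Polynomial.coeff_add, map_add, hp, hq, Polynomial.C_add, add_mul]
    | mul_X p i hp =>
      intro e
      have hX : weightCoaction k w (X i) = Polynomial.C (X i) * Polynomial.X ^ w i := by
        simp [weightCoaction]
      rw [map_mul, hX, ← mul_assoc, coeff_mul_X_pow']
      split_ifs with h
      · rw [coeff_mul_C, map_mul, hp, hX, Polynomial.C_mul]
        conv_rhs => rw [← pow_sub_mul_pow _ h]
        ring
      · simp

variable [Field k]

theorem not_sq_dvd_X_pow_add_X_pow {a b : ℕ} (ha : (a : k) ≠ 0) (hb : (b : k) ≠ 0)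
    {p : MvPolynomial (Fin 2) k} (hp : Prime p) : ¬ p ^ 2 ∣ X 0 ^ a + X 1 ^ b := by
  rintro ⟨q, hq⟩
  have hd : ∀ i, p ∣ pderiv i (X 0 ^ a + X 1 ^ b : MvPolynomial (Fin 2) k) := fun i => by
    rw [hq, Derivation.leibniz, Derivation.leibniz_pow]
    simp only [smul_eq_mul, nsmul_eq_mul]
    exact dvd_add (((dvd_pow_self p two_ne_zero).mul_right _))
      (Dvd.intro (q * (2 * pderiv i p)) (by push_cast; ring))
  have hC : ∀ c : k, c ≠ 0 → ¬ p ∣ C c := fun c hc h =>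
    hp.not_isUnit (isUnit_of_dvd_unit h ((isUnit_iff_ne_zero.2 hc).map C))
  have h0 : p ∣ X 0 := by
    have := hd 0
    rw [map_add, Derivation.leibniz_pow, Derivation.leibniz_pow, pderiv_X_self,
      pderiv_X_of_ne (by decide)] at this
    simp only [smul_eq_mul, nsmul_eq_mul, mul_one, mul_zero, add_zero] at this
    rw [← map_natCast C] at this
    exact hp.dvd_of_dvd_pow ((hp.dvd_or_dvd this).resolve_left (hC _ ha))
  have h1 : p ∣ X 1 := by
    have := hd 1
    rw [map_add, Derivation.leibniz_pow, Derivation.leibniz_pow, pderiv_X_self,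
      pderiv_X_of_ne (by decide)] at this
    simp only [smul_eq_mul, nsmul_eq_mul, mul_one, mul_zero, zero_add] at this
    rw [← map_natCast C] at this
    exact hp.dvd_of_dvd_pow ((hp.dvd_or_dvd this).resolve_left (hC _ hb))
  have h01 := (hp.associated_of_dvd (X_prime (i := (0 : Fin 2)) (R := k)) h0).symm.dvd.trans h1
  exact absurd (X_dvd_X.1 h01) (by decide)

theorem prime_X_pow_add_X_pow_add_X_pow {a b c : ℕ} (ha : 0 < a) (hb : (b : k) ≠ 0)
    (hc : (c : k) ≠ 0) : Prime (X 0 ^ a + X 1 ^ b + X 2 ^ c : MvPolynomial (Fin 3) k) := by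
  have hb0 : b ≠ 0 := by rintro rfl; simp at hb
  have hc0 : c ≠ 0 := by rintro rfl; simp at hc
  set E : MvPolynomial (Fin 2) k := X 0 ^ b + X 1 ^ c with hE
  have hE0 : E ≠ 0 := fun h => by
    have := congrArg (MvPolynomial.eval ![1, 0]) h
    simp [hE, hc0] at this
  have hEu : ¬ IsUnit E := fun h => by
    have := h.map (MvPolynomial.eval (0 : Fin 2 → k))
    simp [hE, hb0, hc0] at this
  obtain ⟨p, hp, hpE⟩ := WfDvdMonoid.exists_irreducible_factor hEu hE0
  replace hp := hp.prime
  rw [← MulEquiv.prime_iff (finSuccEquiv k 2)]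
  have hmap : finSuccEquiv k 2 (X 0 ^ a + X 1 ^ b + X 2 ^ c) =
      (Polynomial.X ^ a + Polynomial.C E : (MvPolynomial (Fin 2) k)[X]) := by
    have h1 : (1 : Fin 3) = Fin.succ 0 := rfl
    have h2 : (2 : Fin 3) = Fin.succ 1 := rfl
    rw [map_add, map_add, map_pow, map_pow, map_pow, h1, h2, finSuccEquiv_X_zero,
      finSuccEquiv_X_succ, finSuccEquiv_X_succ, hE, Polynomial.C_add, Polynomial.C_pow,
      Polynomial.C_pow, add_assoc]
  rw [hmap]
  have hmonic : (Polynomial.X ^ a + Polynomial.C E : (MvPolynomial (Fin 2) k)[X]).Monic :=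
    monic_X_pow_add_C E ha.ne'
  have hdeg : (Polynomial.X ^ a + Polynomial.C E : (MvPolynomial (Fin 2) k)[X]).natDegree = a :=
    natDegree_X_pow_add_C
  refine (IsEisensteinAt.irreducible (𝓟 := Ideal.span {p}) ⟨?_, fun {m} hm => ?_, ?_⟩
    ((Ideal.span_singleton_prime hp.ne_zero).2 hp) hmonic.isPrimitive (by rwa [hdeg])).prime
  · rw [hmonic.leadingCoeff, Ideal.mem_span_singleton]
    exact fun h => hp.not_isUnit (isUnit_of_dvd_one h)
  · rw [hdeg] at hm
    rw [Ideal.mem_span_singleton, Polynomial.coeff_add, Polynomial.coeff_X_pow, if_neg hm.ne,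
      zero_add, Polynomial.coeff_C]
    split_ifs
    · exact hpE
    · exact dvd_zero _
  · rw [Ideal.span_singleton_pow, Ideal.mem_span_singleton, Polynomial.coeff_add,
      Polynomial.coeff_X_pow, if_neg ha.ne, zero_add, Polynomial.coeff_C_zero]
    exact not_sq_dvd_X_pow_add_X_pow hb hc hp

end MvPolynomial

/-- Let `k` be a field and `m₁, m₂, m₃, n` positive integers such that `n` is
relatively prime to each `mᵢ` and the characteristic of `k` is zero or does not divide any
`mᵢ` (equivalently, each `mᵢ` is nonzero in `k`).  Then the hypersurface ring
`R = k[z,x₁,x₂,x₃]/(zⁿ − x₁^{m₁} − x₂^{m₂} − x₃^{m₃})` is a unique factorization domain,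
i.e. it is an integral domain with unique factorization.  Here `k[x₁,x₂,x₃]` is realized as
`MvPolynomial (Fin 3) k` and `R` as the quotient of the polynomial ring in `z` over it. -/
theorem divisor_class_stmt_8 {k : Type*} [Field k] {m₁ m₂ m₃ n : ℕ}
    (hm₁ : 0 < m₁) (hm₂ : 0 < m₂) (hm₃ : 0 < m₃) (hn : 0 < n)
    (hn₁ : Nat.Coprime n m₁) (hn₂ : Nat.Coprime n m₂) (hn₃ : Nat.Coprime n m₃)
    (hc₁ : (m₁ : k) ≠ 0) (hc₂ : (m₂ : k) ≠ 0) (hc₃ : (m₃ : k) ≠ 0) :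
    ∃ hdom : IsDomain (Polynomial (MvPolynomial (Fin 3) k) ⧸
        Ideal.span {Polynomial.X ^ n - Polynomial.C
          (MvPolynomial.X 0 ^ m₁ + MvPolynomial.X 1 ^ m₂ + MvPolynomial.X 2 ^ m₃ :
            MvPolynomial (Fin 3) k)}),
      letI := hdom
      UniqueFactorizationMonoid (Polynomial (MvPolynomial (Fin 3) k) ⧸
        Ideal.span {Polynomial.X ^ n - Polynomial.C
          (MvPolynomial.X 0 ^ m₁ + MvPolynomial.X 1 ^ m₂ + MvPolynomial.X 2 ^ m₃ :
            MvPolynomial (Fin 3) k)}) := by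
  have hδ := MvPolynomial.isGradingCoaction_weightCoaction (k := k)
    ![m₂ * m₃, m₁ * m₃, m₁ * m₂]
  have hF : MvPolynomial.weightCoaction k ![m₂ * m₃, m₁ * m₃, m₁ * m₂]
      (MvPolynomial.X 0 ^ m₁ + MvPolynomial.X 1 ^ m₂ + MvPolynomial.X 2 ^ m₃) =
      C (MvPolynomial.X 0 ^ m₁ + MvPolynomial.X 1 ^ m₂ + MvPolynomial.X 2 ^ m₃) *
        X ^ (m₁ * m₂ * m₃) := by
    simp [MvPolynomial.weightCoaction]
    ring
  have hFp := MvPolynomial.prime_X_pow_add_X_pow_add_X_pow hm₁ hc₂ hc₃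
  have hnd : n.Coprime (m₁ * m₂ * m₃) := (hn₁.mul_right hn₂).mul_right hn₃
  have hdom := RootExtension.isDomain hδ hF hFp.ne_zero hn.ne' hnd
  exact ⟨hdom, RootExtension.uniqueFactorizationMonoid hδ hF hFp hn.ne' hnd⟩
end

section
/- Let k be a field and let m_1, m_2, m_3 be positive integers such that the characteristic of k is zero or does not divide any m_i. Then the polynomial x_1^{m_1} + x_2^{m_2} + x_3^{m_3} is irreducible in the polynomial ring k[x_1,x_2,x_3]. -/
namespace MvPolynomial

/-- Partial derivatives of a polynomial are divisible by each of its repeated factors. -/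
theorem dvd_pderiv_of_mul_self_dvd {R σ : Type*} [CommRing R] {p f : MvPolynomial σ R}
    (h : p * p ∣ f) (i : σ) : p ∣ pderiv i f := by
  obtain ⟨q, rfl⟩ := h
  rw [mul_assoc, Derivation.leibniz, Derivation.leibniz, smul_eq_mul, smul_eq_mul, smul_eq_mul,
    smul_eq_mul]
  exact dvd_add (dvd_mul_right _ _) (Dvd.intro_left _ (by ring :
    (pderiv i p * q) * p = p * q * pderiv i p))

/-- A prime dividing a nonzero constant multiple of a power of `X i` divides `X i`. -/
theorem dvd_X_of_dvd_natCast_mul_X_pow {k σ : Type*} [Field k] {p : MvPolynomial σ k}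
    (hp : Prime p) {m n : ℕ} (hm : (m : k) ≠ 0) {i : σ}
    (h : p ∣ (m : MvPolynomial σ k) * X i ^ n) : p ∣ X i := by
  have hu : IsUnit (m : MvPolynomial σ k) := by
    rw [← map_natCast (C : k →+* MvPolynomial σ k)]
    exact hm.isUnit.map C
  exact hp.dvd_of_dvd_pow (hu.dvd_mul_left.mp h)

theorem not_mul_self_dvd_X_pow_add_X_pow {k σ : Type*} [Field k] {i j : σ} (hij : i ≠ j)
    {m n : ℕ} (hm : (m : k) ≠ 0) (hn : (n : k) ≠ 0) {p : MvPolynomial σ k} (hp : Prime p) :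
    ¬ p * p ∣ X i ^ m + X j ^ n := by
  intro h
  have hi := dvd_pderiv_of_mul_self_dvd h i
  have hj := dvd_pderiv_of_mul_self_dvd h j
  simp only [map_add, Derivation.leibniz_pow, pderiv_X_self, pderiv_X_of_ne hij,
    pderiv_X_of_ne hij.symm, mul_zero, add_zero, zero_add, nsmul_eq_mul, smul_eq_mul,
    mul_one] at hi hj
  have hpi := dvd_X_of_dvd_natCast_mul_X_pow hp hm hi
  have hpj := dvd_X_of_dvd_natCast_mul_X_pow hp hn hj
  have hX : (X i : MvPolynomial σ k) ∣ X j :=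
    ((hp.irreducible.associated_of_dvd X_prime.irreducible hpi).symm.dvd).trans hpj
  exact hij (X_dvd_X.mp hX)

theorem exists_prime_dvd_X_pow_add_X_pow {k σ : Type*} [Field k] {i j : σ} (hij : i ≠ j)
    {m n : ℕ} (hm : 0 < m) (hn : 0 < n) :
    ∃ p : MvPolynomial σ k, Prime p ∧ p ∣ X i ^ m + X j ^ n := by
  classical
  have h_unit : ¬ IsUnit (X i ^ m + X j ^ n : MvPolynomial σ k) := fun h ↦ by
    simpa [hm.ne', hn.ne'] using h.map constantCoeff
  have h_ne : (X i ^ m + X j ^ n : MvPolynomial σ k) ≠ 0 := fun h ↦ by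
    simpa [hij.symm, hn.ne'] using congrArg (eval (Pi.single i 1)) h
  obtain ⟨p, hp, hdvd⟩ := WfDvdMonoid.exists_irreducible_factor h_unit h_ne
  exact ⟨p, hp.prime, hdvd⟩

end MvPolynomial

/-- Eisenstein's criterion for the polynomial `X ^ n + a`. -/
theorem Polynomial.irreducible_X_pow_add_C_of_prime {R : Type*} [CommRing R] [IsDomain R]
    {n : ℕ} (hn : 0 < n) {a p : R} (hp : Prime p) (hdvd : p ∣ a) (hsq : ¬ p * p ∣ a) :
    Irreducible (X ^ n + C a : Polynomial R) := by
  have hmonic : (X ^ n + C a : Polynomial R).Monic := monic_X_pow_add_C a hn.ne'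
  have hprime : (Ideal.span {p}).IsPrime := (Ideal.span_singleton_prime hp.ne_zero).mpr hp
  refine irreducible_of_eisenstein_criterion hprime ?_ ?_ ?_ ?_ hmonic.isPrimitive
  · rw [hmonic.leadingCoeff]
    exact fun h ↦ hprime.ne_top ((Ideal.eq_top_iff_one _).mpr h)
  · intro l hl
    rw [degree_X_pow_add_C hn, Nat.cast_lt] at hl
    rw [coeff_add, coeff_X_pow, if_neg hl.ne, zero_add, coeff_C, Ideal.mem_span_singleton]
    split_ifs
    · exact hdvd
    · exact dvd_zero p
  · rw [degree_X_pow_add_C hn]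
    exact_mod_cast hn
  · simpa [coeff_X_pow, hn.ne, Ideal.span_singleton_pow, Ideal.mem_span_singleton, ← sq] using hsq


/-- Let `k` be a field and `m₁, m₂, m₃` positive integers such that the
characteristic of `k` is zero or does not divide any `mᵢ` (equivalently, each `mᵢ` is nonzero
in `k`).  Then `x₁^{m₁} + x₂^{m₂} + x₃^{m₃}` is irreducible in `k[x₁,x₂,x₃]`, realized as
`MvPolynomial (Fin 3) k`. -/
theorem divisor_class_stmt_9 {k : Type*} [Field k] {m₁ m₂ m₃ : ℕ}
    (hm₁ : 0 < m₁) (hm₂ : 0 < m₂) (hm₃ : 0 < m₃)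
    (hc₁ : (m₁ : k) ≠ 0) (hc₂ : (m₂ : k) ≠ 0) (hc₃ : (m₃ : k) ≠ 0) :
    Irreducible (MvPolynomial.X 0 ^ m₁ + MvPolynomial.X 1 ^ m₂ + MvPolynomial.X 2 ^ m₃ :
      MvPolynomial (Fin 3) k) := by
  have hij : (0 : Fin 2) ≠ 1 := by decide
  obtain ⟨p, hp, hdvd⟩ := MvPolynomial.exists_prime_dvd_X_pow_add_X_pow (k := k) hij hm₂ hm₃
  have h := Polynomial.irreducible_X_pow_add_C_of_prime hm₁ hp hdvd
    (MvPolynomial.not_mul_self_dvd_X_pow_add_X_pow hij hc₂ hc₃ hp)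
  rw [← MulEquiv.irreducible_iff (MvPolynomial.finSuccEquiv k 2)]
  have h1 : (1 : Fin 3) = Fin.succ 0 := rfl
  have h2 : (2 : Fin 3) = Fin.succ 1 := rfl
  rw [h1, h2]
  simpa only [map_add, map_pow, MvPolynomial.finSuccEquiv_X_zero,
    MvPolynomial.finSuccEquiv_X_succ, add_assoc] using h
end

section
/- Let k be a field and let m_1, m_2, n be positive integers with gcd(m_1, m_2) = 1, with n relatively prime to m_1·m_2, and such that the characteristic of k is zero or does not divide m_1 or m_2. Then the hypersurface ring R = k[z,x_1,x_2]/(z^n − x_1^{m_1} − x_2^{m_2}) is a unique factorization domain. -/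
open Polynomial in
/-- For coprime `p` and `q`, a polynomial in `W` of degree `< p` over `K[V]` that vanishes under
`V ↦ X ^ p`, `W ↦ X ^ q` is zero. -/
theorem eq_zero_of_eval₂_expand_eq_zero {K : Type*} [Field K] {p q : ℕ} (hp : 0 < p)
    (hpq : Nat.Coprime p q) {f : K[X][X]} (hf : f.degree < p)
    (h : f.eval₂ (expand K p : K[X] →+* K[X]) (X ^ q) = 0) : f = 0 := by
  by_cases hf0 : f = 0
  · exact hf0
  rw [eval₂_eq_sum_range' _ ((natDegree_lt_iff_degree_lt hf0).2 hf)] at h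
  ext i j
  rcases le_or_gt p i with hi | hi
  · rw [coeff_eq_zero_of_degree_lt (hf.trans_le (by exact_mod_cast hi))]; simp
  have hc := congrArg (fun g => g.coeff (p * j + q * i)) h
  simp only [finsetSum_coeff, ← pow_mul, coeff_mul_X_pow', coeff_zero] at hc
  rw [Finset.sum_eq_single i] at hc
  · simpa [mul_comm p j, coeff_expand_mul hp] using hc
  · intro l hl hli
    split_ifs with hle
    · refine (coeff_expand hp _ _).trans (if_neg fun hd => hli ?_)
      have h1 : q * i ≡ q * l [MOD p] := by
        have h2 : q * l ≡ p * j + q * i [MOD p] := (Nat.modEq_iff_dvd' hle).2 hd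
        refine ((h2.trans ?_).symm)
        simp [Nat.ModEq]
      exact ((Nat.ModEq.cancel_left_of_coprime hpq h1).eq_of_lt_of_lt hi
        (Finset.mem_range.1 hl)).symm
    · rfl
  · intro hni
    exact absurd (Finset.mem_range.2 hi) hni

open Polynomial in
/-- If `R` is generated over `K` by `u`, `v`, `w`, where `u ∣ w ^ p - v ^ q` with `p`, `q` coprime,
and `R → K[X]`, `u ↦ 0`, `v ↦ X ^ p`, `w ↦ X ^ q` is a homomorphism, then `u` is prime. -/
theorem prime_of_algHom_cusp {K R : Type*} [Field K] [CommRing R] [Algebra K R] {p q : ℕ}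
    (hp : 0 < p) (hpq : Nat.Coprime p q) {u v w : R} (hu : u ≠ 0)
    (hgen : ∀ S : Subalgebra K R, u ∈ S → v ∈ S → w ∈ S → S = ⊤)
    (hdvd : u ∣ w ^ p - v ^ q) (φ : R →ₐ[K] K[X])
    (hφu : φ u = 0) (hφv : φ v = X ^ p) (hφw : φ w = X ^ q) : Prime u := by
  rw [← Ideal.span_singleton_prime hu]
  let ψ : K[X][X] →+* R := eval₂RingHom (aeval v : K[X] →ₐ[K] R).toRingHom w
  have hψX : ψ X = w := by simp [ψ]
  have hψC (f : K[X]) : ψ (C f) = aeval v f := by simp [ψ]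
  have hφψ (f : K[X][X]) :
      φ (ψ f) = f.eval₂ (expand K p : K[X] →+* K[X]) (X ^ q) := by
    have : (φ : R →+* K[X]).comp ψ = eval₂RingHom (expand K p : K[X] →+* K[X]) (X ^ q) := by
      ext <;> simp [hψX, hψC, hφw, hφv]
    exact congrArg (fun g : K[X][X] →+* K[X] => g f) this
  have hsurj (r : R) : ∃ f, u ∣ r - ψ f := by
    let π := Ideal.Quotient.mkₐ K (Ideal.span {u})
    have hπ (a b : R) : π a = π b ↔ u ∣ a - b := by
      rw [← Ideal.mem_span_singleton]; exact Ideal.Quotient.eq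
    let S : Subalgebra K R :=
      { carrier := {r | ∃ f, u ∣ r - ψ f}
        mul_mem' := by
          rintro a b ⟨f, hf⟩ ⟨g, hg⟩
          refine ⟨f * g, ?_⟩
          rw [← hπ] at *
          simp [hf, hg]
        add_mem' := by
          rintro a b ⟨f, hf⟩ ⟨g, hg⟩
          refine ⟨f + g, ?_⟩
          rw [← hπ] at *
          simp [hf, hg]
        algebraMap_mem' := fun c => ⟨C (C c), by simp [hψC]⟩ }
    have hS : S = ⊤ := hgen S ⟨0, by simp⟩ ⟨C X, by simp [hψC]⟩ ⟨X, by simp [hψX]⟩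
    exact (hS ▸ Algebra.mem_top : r ∈ S)
  have hker : Ideal.span {u} = RingHom.ker φ := by
    refine le_antisymm ((Ideal.span_singleton_le_iff_mem _).2 hφu) fun r hr => ?_
    rw [RingHom.mem_ker] at hr
    rw [Ideal.mem_span_singleton]
    obtain ⟨f, hf⟩ := hsurj r
    have hm : (X ^ p - C (X ^ q) : K[X][X]).Monic := monic_X_pow_sub_C _ hp.ne'
    set g := f %ₘ (X ^ p - C (X ^ q)) with hg
    have hfg : u ∣ ψ f - ψ g := by
      rw [← map_sub, hg, modByMonic_eq_sub_mul_div, sub_sub_cancel, map_mul]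
      refine Dvd.dvd.mul_right ?_ _
      simpa [hψX, hψC] using hdvd
    have hrg : u ∣ r - ψ g := by simpa using dvd_add hf hfg
    have hg0 : g = 0 := by
      refine eq_zero_of_eval₂_expand_eq_zero hp hpq ?_ ?_
      · exact (degree_modByMonic_lt _ hm).trans_eq (degree_X_pow_sub_C hp _)
      · obtain ⟨s, hs⟩ := hrg
        rw [← hφψ, ← sub_sub_cancel r (ψ g), hs, map_sub, hr, map_mul, hφu]
        simp
    simpa [hg0] using hrg
  rw [hker]
  exact RingHom.ker_isPrime _

/-- Nagata's criterion, for an element which is a prime or a unit. -/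
theorem ufm_of_isLocalizationAway {R : Type*} [CommRing R] [IsDomain R] [IsNoetherianRing R]
    {x : R} (hx : Prime x ∨ IsUnit x) (S : Type*) [CommRing S] [Algebra R S]
    [IsLocalization.Away x S] [UniqueFactorizationMonoid S] : UniqueFactorizationMonoid R := by
  rcases hx with hx | hx
  · exact (UniqueFactorizationMonoid.iff_of_isLocalizationAway_of_prime hx S).2 ‹_›
  · exact (IsLocalization.atUnit R S x hx).symm.toMulEquiv.uniqueFactorizationMonoid ‹_›

theorem prime_or_isUnit_algebraMap {R : Type*} [CommRing R] [IsDomain R] {x y : R} (hx : x ≠ 0)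
    (hy : Prime y ∨ IsUnit y) (S : Type*) [CommRing S] [Algebra R S] [IsLocalization.Away x S] :
    Prime (algebraMap R S y) ∨ IsUnit (algebraMap R S y) := by
  rcases hy with hy | hy
  · refine or_iff_not_imp_right.2 fun h => ?_
    have hinj := IsLocalization.injective S (powers_le_nonZeroDivisors_of_noZeroDivisors hx)
    exact (IsLocalization.toLocalizationMap (Submonoid.powers x) S).map_prime hy
      (by simpa using (map_ne_zero_iff _ hinj).2 hy.ne_zero) h
  · exact Or.inr (hy.map _)

/-- Nagata's criterion for a product of three primes. -/
theorem ufm_of_isLocalizationAway_mul_mul {R : Type*} [CommRing R] [IsDomain R]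
    [IsNoetherianRing R] {x y z : R} (hx : Prime x) (hy : Prime y) (hz : Prime z)
    (h : UniqueFactorizationMonoid (Localization.Away (x * y * z))) :
    UniqueFactorizationMonoid R := by
  let A := Localization.Away x
  let y' := algebraMap R A y
  let B := Localization.Away y'
  have : IsDomain A := Localization.Away.isDomain hx.ne_zero
  have : IsNoetherianRing A := IsLocalization.isNoetherianRing (Submonoid.powers x) A inferInstance
  have hinj : Function.Injective (algebraMap R A) :=
    IsLocalization.injective A (powers_le_nonZeroDivisors_of_noZeroDivisors hx.ne_zero)
  have hy0 : y' ≠ 0 := (map_ne_zero_iff _ hinj).2 hy.ne_zero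
  have : IsDomain B := Localization.Away.isDomain hy0
  have : IsNoetherianRing B := IsLocalization.isNoetherianRing (Submonoid.powers y') B inferInstance
  let z' := algebraMap R B z
  let D := Localization.Away z'
  have hB : IsLocalization.Away (x * y) B := IsLocalization.Away.mul' A B x y
  have hzB : z' = algebraMap A B (algebraMap R A z) := IsScalarTower.algebraMap_apply R A B z
  have hD : IsLocalization.Away (x * y * z) D := IsLocalization.Away.mul' B D (x * y) z
  have hDu : UniqueFactorizationMonoid D :=
    (IsLocalization.algEquiv (Submonoid.powers (x * y * z))
      (Localization.Away (x * y * z)) D).toMulEquiv.uniqueFactorizationMonoid h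
  have hBu : UniqueFactorizationMonoid B := ufm_of_isLocalizationAway
    (hzB ▸ prime_or_isUnit_algebraMap hy0 (prime_or_isUnit_algebraMap hx.ne_zero (.inl hz) A) B) D
  have hAu : UniqueFactorizationMonoid A := ufm_of_isLocalizationAway
    (prime_or_isUnit_algebraMap hx.ne_zero (.inl hy) A) B
  exact ufm_of_isLocalizationAway (.inl hx) A

theorem zsmul_change_of_basis {A : Type*} [AddCommGroup A] {a b n i j l : ℤ}
    (hdet : a * b * l + a * n * j + n * b * i = 1) (P Q T : A) :
    let X := (b * l + n * j) • P + (-(n * j)) • Q + (n * b) • T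
    let Y := (-(n * i)) • P + (a * l + n * i) • Q + (n * a) • T
    let Z := (-(b * i)) • P + (-(a * j)) • Q + (a * b) • T
    a • X - n • Z = P ∧ b • Y - n • Z = Q ∧ i • X + j • Y + l • Z = T := by
  refine ⟨?_, ?_, ?_⟩
  · match_scalars <;> first | ring1 | linear_combination hdet
  · match_scalars <;> first | ring1 | linear_combination hdet
  · match_scalars <;> first | ring1 | linear_combination hdet

theorem zsmul_change_of_basis_symm {A : Type*} [AddCommGroup A] {a b n i j l : ℤ}
    (hdet : a * b * l + a * n * j + n * b * i = 1) (X Y Z : A) :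
    let P := a • X - n • Z
    let Q := b • Y - n • Z
    let T := i • X + j • Y + l • Z
    (b * l + n * j) • P + (-(n * j)) • Q + (n * b) • T = X ∧
    (-(n * i)) • P + (a * l + n * i) • Q + (n * a) • T = Y ∧
    (-(b * i)) • P + (-(a * j)) • Q + (a * b) • T = Z := by
  refine ⟨?_, ?_, ?_⟩
  · match_scalars <;> first | ring1 | linear_combination hdet
  · match_scalars <;> first | ring1 | linear_combination hdet
  · match_scalars <;> first | ring1 | linear_combination hdet

theorem zpow_change_of_basis {G : Type*} [CommGroup G] {a b n i j l : ℤ}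
    (hdet : a * b * l + a * n * j + n * b * i = 1) (P Q T : G) :
    let X := P ^ (b * l + n * j) * Q ^ (-(n * j)) * T ^ (n * b)
    let Y := P ^ (-(n * i)) * Q ^ (a * l + n * i) * T ^ (n * a)
    let Z := P ^ (-(b * i)) * Q ^ (-(a * j)) * T ^ (a * b)
    X ^ a / Z ^ n = P ∧ Y ^ b / Z ^ n = Q ∧ X ^ i * Y ^ j * Z ^ l = T :=
  zsmul_change_of_basis (A := Additive G) hdet P Q T

theorem zpow_change_of_basis_symm {G : Type*} [CommGroup G] {a b n i j l : ℤ}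
    (hdet : a * b * l + a * n * j + n * b * i = 1) (X Y Z : G) :
    let P := X ^ a / Z ^ n
    let Q := Y ^ b / Z ^ n
    let T := X ^ i * Y ^ j * Z ^ l
    P ^ (b * l + n * j) * Q ^ (-(n * j)) * T ^ (n * b) = X ∧
    P ^ (-(n * i)) * Q ^ (a * l + n * i) * T ^ (n * a) = Y ∧
    P ^ (-(b * i)) * Q ^ (-(a * j)) * T ^ (a * b) = Z :=
  zsmul_change_of_basis_symm (A := Additive G) hdet X Y Z

theorem exists_mul_add_mul_add_mul_eq_one {a b n : ℕ} (hab : Nat.Coprime a b)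
    (hn : Nat.Coprime n (a * b)) :
    ∃ i j l : ℤ, (a * b * l + a * n * j + n * b * i : ℤ) = 1 := by
  obtain ⟨u, v, huv⟩ := Nat.isCoprime_iff_coprime.2 hab
  obtain ⟨s, t, hst⟩ := Nat.isCoprime_iff_coprime.2 hn
  push_cast at hst
  exact ⟨s * v, s * u, t, by linear_combination hst + s * n * huv⟩

open Polynomial in
/-- The Brieskorn ring `k[z, x, y] / (z ^ n - x ^ a - y ^ b)`. -/
def BrieskornRing (k : Type*) [Field k] (a b n : ℕ) : Type _ :=
  (MvPolynomial (Fin 2) k)[X] ⧸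
    Ideal.span {X ^ n - C (MvPolynomial.X 0 ^ a + MvPolynomial.X 1 ^ b : MvPolynomial (Fin 2) k)}

namespace BrieskornRing

open Polynomial

variable {k : Type*} [Field k] {a b n : ℕ}

noncomputable instance : CommRing (BrieskornRing k a b n) := Ideal.Quotient.commRing _

noncomputable instance : Algebra k (BrieskornRing k a b n) := Ideal.instAlgebraQuotient k _

instance : IsNoetherianRing (BrieskornRing k a b n) := Ideal.Quotient.isNoetherianRing _

variable (k a b n) in
/-- The quotient map. -/
noncomputable def mk : (MvPolynomial (Fin 2) k)[X] →+* BrieskornRing k a b n := Ideal.Quotient.mk _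

variable (k a b n) in
/-- The class of the first variable of the base. -/
noncomputable def x : BrieskornRing k a b n := mk k a b n (C (MvPolynomial.X 0))

variable (k a b n) in
/-- The class of the second variable of the base. -/
noncomputable def y : BrieskornRing k a b n := mk k a b n (C (MvPolynomial.X 1))

variable (k a b n) in
/-- The class of the adjoined root. -/
noncomputable def z : BrieskornRing k a b n := mk k a b n X

theorem z_pow : z k a b n ^ n = x k a b n ^ a + y k a b n ^ b := by
  simp only [x, y, z, ← map_pow, ← map_add]
  exact Ideal.Quotient.eq.2 (Ideal.mem_span_singleton_self _)

section Lift

variable {S : Type*} [CommRing S] [Algebra k S] {X₀ Y₀ Z₀ : S} (h : Z₀ ^ n = X₀ ^ a + Y₀ ^ b)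

variable (k) in
/-- The homomorphism out of the Brieskorn ring defined by a solution of its equation. -/
noncomputable def lift : BrieskornRing k a b n →ₐ[k] S :=
  Ideal.Quotient.liftₐ _ (eval₂AlgHom (MvPolynomial.aeval ![X₀, Y₀]) Z₀ fun _ => .all _ _) <| by
    intro f hf
    rw [← RingHom.mem_ker]
    refine (Ideal.span_singleton_le_iff_mem _).2 ?_ hf
    change eval₂ (MvPolynomial.aeval ![X₀, Y₀] : MvPolynomial (Fin 2) k →ₐ[k] S).toRingHom Z₀ _ = 0
    rw [eval₂_sub, eval₂_X_pow, eval₂_C, h]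
    simp

@[simp] theorem lift_mk (f : (MvPolynomial (Fin 2) k)[X]) : lift k h (mk k a b n f) =
    f.eval₂ (MvPolynomial.aeval ![X₀, Y₀] : MvPolynomial (Fin 2) k →ₐ[k] S).toRingHom Z₀ :=
  rfl

@[simp] theorem lift_x : lift k h (x k a b n) = X₀ := by
  simp [x]

@[simp] theorem lift_y : lift k h (y k a b n) = Y₀ := by
  simp [y]

@[simp] theorem lift_z : lift k h (z k a b n) = Z₀ := by
  simp [z]

end Lift

theorem subalgebra_eq_top {S : Subalgebra k (BrieskornRing k a b n)} (hx : x k a b n ∈ S)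
    (hy : y k a b n ∈ S) (hz : z k a b n ∈ S) : S = ⊤ := by
  rw [eq_top_iff]
  rintro r -
  obtain ⟨f, rfl⟩ : ∃ f, mk k a b n f = r := Ideal.Quotient.mk_surjective r
  induction f using Polynomial.induction_on' with
  | add p q hp hq => rw [map_add]; exact add_mem hp hq
  | monomial m p =>
    rw [← C_mul_X_pow_eq_monomial, map_mul, map_pow]
    refine mul_mem ?_ (pow_mem hz m)
    induction p using MvPolynomial.induction_on with
    | C c => exact S.algebraMap_mem c
    | add p q hp hq => rw [C_add, map_add]; exact add_mem hp hq
    | mul_X p i hp =>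
      rw [C_mul, map_mul]
      refine mul_mem hp ?_
      fin_cases i
      · exact hx
      · exact hy

theorem algHom_ext {S : Type*} [CommRing S] [Algebra k S] {f g : BrieskornRing k a b n →ₐ[k] S}
    (hx : f (x k a b n) = g (x k a b n)) (hy : f (y k a b n) = g (y k a b n))
    (hz : f (z k a b n) = g (z k a b n)) : f = g :=
  AlgHom.equalizer_eq_top.1 (subalgebra_eq_top hx hy hz)

theorem exists_signs (hab : Nat.Coprime a b) :
    ∃ ε δ : k, ε * ε = 1 ∧ δ * δ = 1 ∧ ε ^ a = - δ ^ b := by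
  rcases Nat.even_or_odd a with ha | ha
  · have hb : Odd b := by
      rw [← Nat.not_even_iff_odd]
      intro hb
      exact absurd (hab ▸ Nat.dvd_gcd ha.two_dvd hb.two_dvd) (by norm_num)
    exact ⟨1, -1, by simp, by simp, by simp [hb.neg_one_pow]⟩
  · exact ⟨-1, 1, by simp, by simp, by simp [ha.neg_one_pow]⟩

theorem isDomain (hn : 0 < n) (hab : Nat.Coprime a b) (hc : (a : k) ≠ 0) :
    IsDomain (BrieskornRing k a b n) := by
  obtain ⟨ε, δ, hε, hδ, hεδ⟩ := exists_signs (k := k) hab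
  have hε0 : ε ≠ 0 := left_ne_zero_of_mul_eq_one hε
  let F : MvPolynomial (Fin 2) k := MvPolynomial.X 0 ^ a + MvPolynomial.X 1 ^ b
  let φ : MvPolynomial (Fin 2) k →ₐ[k] k[X] :=
    MvPolynomial.aeval ![C ε * X ^ b, C δ * X ^ a]
  have hF : φ F = 0 := by
    have h : φ F = (C ε * X ^ b) ^ a + (C δ * X ^ a) ^ b := by simp [F, φ]
    rw [h, mul_pow, mul_pow, ← C_pow, ← C_pow, hεδ, ← pow_mul, ← pow_mul, mul_comm b a]
    simp
  have hF2 : F ∉ RingHom.ker φ ^ 2 := by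
    intro h
    have key : φ (MvPolynomial.pderiv 0 F) = 0 := by
      rw [pow_two] at h
      refine Submodule.mul_induction_on h (fun f hf g hg => ?_) fun f g hf hg => ?_
      · rw [RingHom.mem_ker] at hf hg
        simp [Derivation.leibniz, hf, hg]
      · simp [hf, hg]
    have : φ (MvPolynomial.pderiv 0 F) = C (a : k) * (C ε * X ^ b) ^ (a - 1) := by
      simp [F, φ, MvPolynomial.pderiv_X, Derivation.leibniz_pow]
    exact mul_ne_zero (C_ne_zero.2 hc)
      (pow_ne_zero _ (mul_ne_zero (C_ne_zero.2 hε0) (pow_ne_zero _ X_ne_zero))) (this ▸ key)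
  have hmon : (X ^ n - C F).Monic := monic_X_pow_sub_C F hn.ne'
  have hdeg : (X ^ n - C F).degree = (n : WithBot ℕ) := degree_X_pow_sub_C hn F
  have hirr : Irreducible (X ^ n - C F) := by
    refine irreducible_of_eisenstein_criterion (RingHom.ker_isPrime φ) ?_ ?_ ?_ ?_
      hmon.isPrimitive
    · rw [hmon.leadingCoeff, RingHom.mem_ker, map_one]; exact one_ne_zero
    · intro m hm
      rw [hdeg, Nat.cast_lt] at hm
      rw [RingHom.mem_ker, coeff_sub, coeff_X_pow, if_neg hm.ne, coeff_C]
      split_ifs <;> simp [hF]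
    · rw [hdeg]; exact_mod_cast hn
    · simpa [coeff_X_pow, hn.ne] using hF2
  have := (Ideal.span_singleton_prime hmon.ne_zero).2 hirr.prime
  exact Ideal.Quotient.isDomain _

variable (k n) in
/-- The curve `x = 0`. -/
noncomputable def toCurveX (b : ℕ) (ha : a ≠ 0) : BrieskornRing k a b n →ₐ[k] k[X] :=
  lift k (X₀ := 0) (Y₀ := X ^ n) (Z₀ := X ^ b) <| by
    rw [zero_pow ha, zero_add, ← pow_mul, ← pow_mul, mul_comm]

variable (k n) in
/-- The curve `y = 0`. -/
noncomputable def toCurveY (a : ℕ) (hb : b ≠ 0) : BrieskornRing k a b n →ₐ[k] k[X] :=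
  lift k (X₀ := X ^ n) (Y₀ := 0) (Z₀ := X ^ a) <| by
    rw [zero_pow hb, add_zero, ← pow_mul, ← pow_mul, mul_comm]

theorem x_ne_zero (hb : b ≠ 0) : x k a b n ≠ 0 := fun h => by
  simpa [toCurveY] using congrArg (toCurveY k n a hb) h

theorem y_ne_zero (ha : a ≠ 0) : y k a b n ≠ 0 := fun h => by
  simpa [toCurveX] using congrArg (toCurveX k n b ha) h

theorem z_ne_zero (hb : b ≠ 0) : z k a b n ≠ 0 := fun h => by
  simpa [toCurveY] using congrArg (toCurveY k n a hb) h

theorem prime_x (ha : a ≠ 0) (hb : b ≠ 0) (hn : 0 < n) (h : Nat.Coprime n b) :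
    Prime (x k a b n) := by
  refine prime_of_algHom_cusp hn h (x_ne_zero hb) (v := y k a b n) (w := z k a b n)
    (fun S hx hy hz => subalgebra_eq_top hx hy hz) ?_ (toCurveX k n b ha) ?_ ?_ ?_
  · rw [z_pow, add_sub_cancel_right]; exact dvd_pow_self (x k a b n) ha
  all_goals simp [toCurveX]

theorem prime_y (ha : a ≠ 0) (hb : b ≠ 0) (hn : 0 < n) (h : Nat.Coprime n a) :
    Prime (y k a b n) := by
  refine prime_of_algHom_cusp hn h (y_ne_zero ha) (v := x k a b n) (w := z k a b n)
    (fun S hy hx hz => subalgebra_eq_top hx hy hz) ?_ (toCurveY k n a hb) ?_ ?_ ?_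
  · rw [z_pow, add_sub_cancel_left]; exact dvd_pow_self (y k a b n) hb
  all_goals simp [toCurveY]

theorem prime_z (ha : 0 < a) (hb : b ≠ 0) (hn : n ≠ 0) (h : Nat.Coprime a b) :
    Prime (z k a b n) := by
  obtain ⟨ε, δ, hε, hδ, hεδ⟩ := exists_signs (k := k) h
  refine prime_of_algHom_cusp ha h (z_ne_zero hb) (v := δ • y k a b n) (w := ε • x k a b n)
    (fun S hz hy hx => subalgebra_eq_top ?_ ?_ hz) ?_
    (lift k (X₀ := ε • X ^ b) (Y₀ := δ • X ^ a) (Z₀ := 0) ?_) ?_ ?_ ?_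
  · simpa [smul_smul, hε] using S.smul_mem hx ε
  · simpa [smul_smul, hδ] using S.smul_mem hy δ
  · refine (dvd_pow_self (z k a b n) hn).trans ⟨algebraMap k _ (ε ^ a), ?_⟩
    have hδb : δ ^ b = - ε ^ a := by rw [hεδ, neg_neg]
    rw [z_pow, _root_.smul_pow, _root_.smul_pow, hδb, Algebra.smul_def, Algebra.smul_def, map_neg]
    ring
  · rw [zero_pow hn, _root_.smul_pow, _root_.smul_pow, hεδ, ← pow_mul, ← pow_mul, mul_comm]; simp
  · simp
  · simp [smul_smul, hδ]
  · simp [smul_smul, hε]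

variable (k) in
/-- The coordinate ring of the open set `p (1 - p) t ≠ 0` of the plane. -/
abbrev PlaneAway : Type _ :=
  Localization.Away (MvPolynomial.X 0 * (1 - MvPolynomial.X 0) * MvPolynomial.X 1 :
    MvPolynomial (Fin 2) k)

/-- If `a`, `b`, `n` are pairwise coprime, the locus `x y z ≠ 0` of the Brieskorn surface is
isomorphic to the open set `p (1 - p) t ≠ 0` of the plane, where `p = x ^ a / z ^ n`. -/
theorem nonempty_algEquiv_planeAway (hab : Nat.Coprime a b) (hn : Nat.Coprime n (a * b)) :
    Nonempty (Localization.Away (x k a b n * y k a b n * z k a b n) ≃ₐ[k] PlaneAway k) := by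
  obtain ⟨i, j, l, hdet⟩ := exists_mul_add_mul_add_mul_eq_one hab hn
  set L := Localization.Away (x k a b n * y k a b n * z k a b n)
  set B := PlaneAway k
  let ι : BrieskornRing k a b n →ₐ[k] L := Algebra.algHom k (BrieskornRing k a b n) L
  let κ : MvPolynomial (Fin 2) k →ₐ[k] B := Algebra.algHom k (MvPolynomial (Fin 2) k) B
  have hL : IsUnit (ι (x k a b n * y k a b n * z k a b n)) :=
    IsLocalization.Away.algebraMap_isUnit _
  have hB : IsUnit (κ (MvPolynomial.X 0 * (1 - MvPolynomial.X 0) * MvPolynomial.X 1)) :=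
    IsLocalization.Away.algebraMap_isUnit _
  simp only [map_mul, IsUnit.mul_iff] at hL hB
  obtain ⟨⟨⟨xL, hxL⟩, yL, hyL⟩, zL, hzL⟩ := hL
  obtain ⟨⟨⟨pB, hpB⟩, qB, hqB⟩, tB, htB⟩ := hB
  let pL := xL ^ (a : ℤ) / zL ^ (n : ℤ)
  let qL := yL ^ (b : ℤ) / zL ^ (n : ℤ)
  let tL := xL ^ i * yL ^ j * zL ^ l
  let xB := pB ^ (b * l + n * j) * qB ^ (-(n * j)) * tB ^ (n * b : ℤ)
  let yB := pB ^ (-(n * i)) * qB ^ (a * l + n * i) * tB ^ (n * a : ℤ)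
  let zB := pB ^ (-(b * i)) * qB ^ (-(a * j)) * tB ^ (a * b : ℤ)
  obtain ⟨hp, hq, ht⟩ : xB ^ (a : ℤ) / zB ^ (n : ℤ) = pB ∧ yB ^ (b : ℤ) / zB ^ (n : ℤ) = qB ∧
      xB ^ i * yB ^ j * zB ^ l = tB := zpow_change_of_basis hdet pB qB tB
  obtain ⟨hx, hy, hz⟩ : pL ^ (b * l + n * j) * qL ^ (-(n * j)) * tL ^ (n * b : ℤ) = xL ∧
      pL ^ (-(n * i)) * qL ^ (a * l + n * i) * tL ^ (n * a : ℤ) = yL ∧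
      pL ^ (-(b * i)) * qL ^ (-(a * j)) * tL ^ (a * b : ℤ) = zL :=
    zpow_change_of_basis_symm hdet xL yL zL
  have hpq : (qB : B) = 1 - pB := by simp [hqB, hpB]
  have hB : (zB : B) ^ n = xB ^ a + yB ^ b := by
    have h1 : xB ^ a = pB * zB ^ n := by rw [← hp]; simp
    have h2 : yB ^ b = qB * zB ^ n := by rw [← hq]; simp
    simp only [← Units.val_pow_eq_pow_val, h1, h2, Units.val_mul, hpq]
    ring
  have hL : (qL : L) = 1 - pL := by
    have h1 : xL ^ a = pL * zL ^ n := by simp [pL]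
    have h2 : yL ^ b = qL * zL ^ n := by simp [qL]
    have h3 : (zL : L) ^ n = xL ^ a + yL ^ b := by
      rw [hxL, hyL, hzL, ← map_pow, z_pow]; simp
    refine (zL ^ n).isUnit.mul_right_cancel ?_
    simp only [← Units.val_pow_eq_pow_val, h1, h2, Units.val_mul] at h3
    linear_combination -h3
  let φ₀ : BrieskornRing k a b n →ₐ[k] B := lift k hB
  let ψ₀ : MvPolynomial (Fin 2) k →ₐ[k] L := MvPolynomial.aeval ![(pL : L), tL]
  have hφx : φ₀ (x k a b n) = xB := lift_x hB
  have hφy : φ₀ (y k a b n) = yB := lift_y hB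
  have hφz : φ₀ (z k a b n) = zB := lift_z hB
  have hψp : ψ₀ (MvPolynomial.X 0) = pL := by simp [ψ₀]
  have hψt : ψ₀ (MvPolynomial.X 1) = tL := by simp [ψ₀]
  have hφu : IsUnit (φ₀ (x k a b n * y k a b n * z k a b n)) := by
    rw [map_mul, map_mul, hφx, hφy, hφz]
    exact (xB * yB * zB).isUnit
  have hψu : IsUnit (ψ₀ (MvPolynomial.X 0 * (1 - MvPolynomial.X 0) * MvPolynomial.X 1)) := by
    rw [map_mul, map_mul, map_sub, map_one, hψp, hψt, ← hL]
    exact (pL * qL * tL).isUnit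
  let φ : L →ₐ[k] B := IsLocalization.Away.liftAlgHom _ hφu
  let ψ : B →ₐ[k] L := IsLocalization.Away.liftAlgHom _ hψu
  have hφ (r) : φ (ι r) = φ₀ r := IsLocalization.Away.lift_eq _ hφu r
  have hψ (r) : ψ (κ r) = ψ₀ r := IsLocalization.Away.lift_eq _ hψu r
  have hxLB : Units.map φ xL = xB := Units.ext <| by simp [hxL, hφ, hφx]
  have hyLB : Units.map φ yL = yB := Units.ext <| by simp [hyL, hφ, hφy]
  have hzLB : Units.map φ zL = zB := Units.ext <| by simp [hzL, hφ, hφz]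
  have hpBL : Units.map ψ pB = pL := Units.ext <| by simp [hpB, hψ, hψp]
  have hqBL : Units.map ψ qB = qL := Units.ext <| by simp [hqB, hψ, hψp, hL]
  have htBL : Units.map ψ tB = tL := Units.ext <| by simp [htB, hψ, hψt]
  have hpLB : φ pL = pB := congrArg Units.val (show Units.map φ pL = pB by
    simp only [pL, _root_.map_div, map_zpow, hxLB, hzLB, hp])
  have htLB : φ tL = tB := congrArg Units.val (show Units.map φ tL = tB by
    simp only [tL, map_mul, map_zpow, hxLB, hyLB, hzLB, ht])
  have hxBL : ψ xB = xL := congrArg Units.val (show Units.map ψ xB = xL by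
    simp only [xB, map_mul, map_zpow, hpBL, hqBL, htBL, hx])
  have hyBL : ψ yB = yL := congrArg Units.val (show Units.map ψ yB = yL by
    simp only [yB, map_mul, map_zpow, hpBL, hqBL, htBL, hy])
  have hzBL : ψ zB = zL := congrArg Units.val (show Units.map ψ zB = zL by
    simp only [zB, map_mul, map_zpow, hpBL, hqBL, htBL, hz])
  refine ⟨AlgEquiv.ofAlgHom φ ψ ?_ ?_⟩
  · refine IsLocalization.algHom_ext (A := MvPolynomial (Fin 2) k) (Submonoid.powers
      (MvPolynomial.X 0 * (1 - MvPolynomial.X 0) * MvPolynomial.X 1)) ?_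
    refine MvPolynomial.algHom_ext fun m => ?_
    change φ (ψ (κ _)) = κ _
    rw [hψ]
    fin_cases m
    · exact (congrArg φ hψp).trans (hpLB.trans hpB)
    · exact (congrArg φ hψt).trans (htLB.trans htB)
  · refine IsLocalization.algHom_ext (A := BrieskornRing k a b n)
      (Submonoid.powers (x k a b n * y k a b n * z k a b n)) ?_
    apply algHom_ext
    · change ψ (φ (ι _)) = ι _
      rw [hφ, hφx, hxBL, hxL]
    · change ψ (φ (ι _)) = ι _
      rw [hφ, hφy, hyBL, hyL]
    · change ψ (φ (ι _)) = ι _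
      rw [hφ, hφz, hzBL, hzL]

theorem uniqueFactorizationMonoid [IsDomain (BrieskornRing k a b n)] (ha : 0 < a) (hb : 0 < b)
    (hn : 0 < n) (hab : Nat.Coprime a b) (hnab : Nat.Coprime n (a * b)) :
    UniqueFactorizationMonoid (BrieskornRing k a b n) := by
  obtain ⟨e⟩ := nonempty_algEquiv_planeAway (k := k) hab hnab
  exact ufm_of_isLocalizationAway_mul_mul
    (prime_x ha.ne' hb.ne' hn hnab.coprime_mul_left_right)
    (prime_y ha.ne' hb.ne' hn hnab.coprime_mul_right_right)
    (prime_z ha hb.ne' hn.ne' hab)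
    (e.symm.toMulEquiv.uniqueFactorizationMonoid inferInstance)

end BrieskornRing

/-- Let `k` be a field and `m₁, m₂, n` positive integers with
`gcd(m₁, m₂) = 1`, with `n` relatively prime to `m₁·m₂`, and such that the characteristic of
`k` is zero or does not divide `m₁` or `m₂` (equivalently, `m₁` and `m₂` are nonzero in `k`).
Then the hypersurface ring `R = k[z,x₁,x₂]/(zⁿ − x₁^{m₁} − x₂^{m₂})` is a unique
factorization domain, i.e. an integral domain with unique factorization.  Here `k[x₁,x₂]` is
realized as `MvPolynomial (Fin 2) k` and `R` as the quotient of the polynomial ring in `z`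
over it. -/
theorem divisor_class_stmt_10 {k : Type*} [Field k] {m₁ m₂ n : ℕ}
    (hm₁ : 0 < m₁) (hm₂ : 0 < m₂) (hn : 0 < n)
    (hm : Nat.Coprime m₁ m₂) (hnm : Nat.Coprime n (m₁ * m₂))
    (hc₁ : (m₁ : k) ≠ 0) (hc₂ : (m₂ : k) ≠ 0) :
    ∃ hdom : IsDomain (Polynomial (MvPolynomial (Fin 2) k) ⧸
        Ideal.span {Polynomial.X ^ n - Polynomial.C
          (MvPolynomial.X 0 ^ m₁ + MvPolynomial.X 1 ^ m₂ : MvPolynomial (Fin 2) k)}),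
      letI := hdom
      UniqueFactorizationMonoid (Polynomial (MvPolynomial (Fin 2) k) ⧸
        Ideal.span {Polynomial.X ^ n - Polynomial.C
          (MvPolynomial.X 0 ^ m₁ + MvPolynomial.X 1 ^ m₂ : MvPolynomial (Fin 2) k)}) := by
  have hdom : IsDomain (BrieskornRing k m₁ m₂ n) := BrieskornRing.isDomain hn hm hc₁
  exact ⟨hdom, BrieskornRing.uniqueFactorizationMonoid hm₁ hm₂ hn hm hnm⟩
end

section
/- Let k be a field and let n ≥ 2 be an integer. Then the k-subalgebra R = k[xy, x^n, y^n] of the polynomial ring k[x,y] is not a unique factorization domain; indeed, the ideal of R generated by xy and x^n is a height-one prime ideal of R that is not principal. -/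
open MvPolynomial in
/-- The algebra `k[xy, xⁿ, yⁿ]`, as a subalgebra of `k[x, y]`. -/
noncomputable abbrev cyclicSurface (k : Type*) [Field k] (n : ℕ) :
    Subalgebra k (MvPolynomial (Fin 2) k) :=
  Algebra.adjoin k {(X 0 * X 1 : MvPolynomial (Fin 2) k), X 0 ^ n, X 1 ^ n}

/-- A height-one prime ideal of a unique factorization domain is principal. -/
theorem Ideal.isPrincipal_of_height_eq_one {R : Type*} [CommRing R] [IsDomain R]
    [UniqueFactorizationMonoid R] {P : Ideal R} [hP : P.IsPrime] (h : P.height = 1) :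
    P.IsPrincipal := by
  obtain ⟨p, hpP, hp⟩ := hP.exists_mem_prime_of_ne_bot (Ideal.ne_bot_of_height_eq_one h)
  have hprime : (Ideal.span {p}).IsPrime := (Ideal.span_singleton_prime hp.ne_zero).2 hp
  have hle : Ideal.span {p} ≤ P := (Ideal.span_singleton_le_iff_mem P).2 hpP
  rcases hle.eq_or_lt with heq | hlt
  · exact ⟨p, heq.symm⟩
  · have hheight := Ideal.height_add_one_le_of_lt_of_isPrime hlt
    rw [h] at hheight
    have hzero : (Ideal.span {p}).height = 0 := by
      by_contra hne
      have hone := Order.one_le_iff_ne_zero.2 hne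
      have htwo : (1 : ℕ∞) + 1 ≤ 1 := (add_le_add_left hone 1).trans hheight
      exact absurd htwo (by decide)
    exact absurd (Ideal.span_singleton_eq_bot.1 (Ideal.height_eq_zero_iff_eq_bot.1 hzero))
      hp.ne_zero

namespace cyclicSurface

open MvPolynomial

variable {k : Type*} [Field k] {n : ℕ}

instance : IsNoetherianRing (cyclicSurface k n) :=
  isNoetherianRing_of_fg (Subalgebra.fg_def.2 ⟨_, Set.toFinite _, rfl⟩)

/-- The evaluation `x ↦ 0` on `k[x, y]`. -/
noncomputable def evalXZero (k : Type*) [Field k] :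
    MvPolynomial (Fin 2) k →ₐ[k] MvPolynomial (Fin 2) k :=
  aeval ![0, X 1]

theorem exists_sub_mem_span (hn : 2 ≤ n) {u v : cyclicSurface k n}
    (hu : (u : MvPolynomial (Fin 2) k) = X 0 * X 1) (hv : (v : MvPolynomial (Fin 2) k) = X 0 ^ n)
    (r : cyclicSurface k n) :
    ∃ s : cyclicSurface k n,
      (s : MvPolynomial (Fin 2) k) = evalXZero k r ∧ r - s ∈ Ideal.span {u, v} := by
  obtain ⟨r, hr⟩ := r
  induction hr using Algebra.adjoin_induction with
  | mem x hx =>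
    have hx' := hx
    simp only [Set.mem_insert_iff, Set.mem_singleton_iff] at hx'
    rcases hx' with h | h | h
    · refine ⟨0, by simp [h, evalXZero], Ideal.subset_span (Or.inl (Subtype.ext ?_))⟩
      simp [h, hu]
    · refine ⟨0, by simp [h, evalXZero, show n ≠ 0 by lia],
        Ideal.subset_span (Or.inr (Subtype.ext ?_))⟩
      simp [h, hv]
    · exact ⟨⟨x, Algebra.subset_adjoin hx⟩, by simp [h, evalXZero], by simp⟩
  | algebraMap c =>
    exact ⟨algebraMap k _ c, by simp [evalXZero],
      (sub_self (algebraMap k (cyclicSurface k n) c)) ▸ zero_mem _⟩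
  | add x y hx hy ihx ihy =>
    obtain ⟨s, hs, hsm⟩ := ihx
    obtain ⟨t, ht, htm⟩ := ihy
    refine ⟨s + t, by simp [hs, ht], ?_⟩
    convert add_mem hsm htm using 1
    exact Subtype.ext (by push_cast; ring)
  | mul x y hx hy ihx ihy =>
    obtain ⟨s, hs, hsm⟩ := ihx
    obtain ⟨t, ht, htm⟩ := ihy
    refine ⟨s * t, by simp [hs, ht], ?_⟩
    convert add_mem (Ideal.mul_mem_right ⟨y, hy⟩ _ hsm) (Ideal.mul_mem_left _ s htm) using 1
    exact Subtype.ext (by push_cast; ring)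

theorem span_eq_ker (hn : 2 ≤ n) {u v : cyclicSurface k n}
    (hu : (u : MvPolynomial (Fin 2) k) = X 0 * X 1)
    (hv : (v : MvPolynomial (Fin 2) k) = X 0 ^ n) :
    Ideal.span {u, v} = RingHom.ker ((evalXZero k).comp (cyclicSurface k n).val) := by
  apply le_antisymm
  · rw [Ideal.span_le]
    rintro r (rfl | rfl)
    · simp [RingHom.mem_ker, hu, evalXZero]
    · simp [RingHom.mem_ker, hv, evalXZero, show n ≠ 0 by lia]
  · intro r hr
    obtain ⟨s, hs, hrs⟩ := exists_sub_mem_span hn hu hv r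
    have hr' : evalXZero k r = 0 := hr
    have hs0 : s = 0 := Subtype.ext (hs.trans hr')
    simpa [hs0] using hrs

theorem isPrime_span (hn : 2 ≤ n) {u v : cyclicSurface k n}
    (hu : (u : MvPolynomial (Fin 2) k) = X 0 * X 1)
    (hv : (v : MvPolynomial (Fin 2) k) = X 0 ^ n) : (Ideal.span {u, v}).IsPrime := by
  rw [span_eq_ker hn hu hv]
  exact RingHom.ker_isPrime _

theorem height_span (hn : 2 ≤ n) {u v : cyclicSurface k n}
    (hu : (u : MvPolynomial (Fin 2) k) = X 0 * X 1)
    (hv : (v : MvPolynomial (Fin 2) k) = X 0 ^ n) : (Ideal.span {u, v}).height = 1 := by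
  have hp := isPrime_span hn hu hv
  apply le_antisymm
  · refine Ideal.height_le_one_of_isPrincipal_of_mem_minimalPrimes (Ideal.span {v}) _
      ⟨⟨hp, Ideal.span_mono (by simp)⟩, ?_⟩
    rintro Q ⟨hQ, hvQ⟩ -
    have hvQ' : v ∈ Q := (Ideal.span_singleton_le_iff_mem Q).1 hvQ
    rw [Ideal.span_le]
    rintro r (rfl | rfl)
    · refine hQ.mem_of_pow_mem n ?_
      have hpow : r ^ n = v * ⟨X 1 ^ n, Algebra.subset_adjoin (by simp)⟩ :=
        Subtype.ext (by simp [hu, hv, mul_pow])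
      rw [hpow]
      exact Q.mul_mem_right _ hvQ'
    · exact hvQ'
  · rw [Order.one_le_iff_ne_zero, Ne, Ideal.height_eq_zero_iff_eq_bot]
    intro hbot
    have hv0 : v = 0 := by
      rw [← Ideal.mem_bot, ← hbot]
      exact Ideal.subset_span (by simp)
    rw [hv0] at hv
    exact pow_ne_zero n (X_ne_zero 0) hv.symm

/-- The first-order jet at the origin along the `x`-axis, `x ↦ ε` and `y ↦ 0`. -/
noncomputable def jet (k : Type*) [Field k] : MvPolynomial (Fin 2) k →ₐ[k] DualNumber k :=
  aeval ![DualNumber.eps, 0]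

theorem snd_jet_eq_zero (hn : 2 ≤ n) (r : cyclicSurface k n) : (jet k r).snd = 0 := by
  have hle : cyclicSurface k n ≤ (⊥ : Subalgebra k (DualNumber k)).comap (jet k) := by
    refine Algebra.adjoin_le ?_
    rintro x (rfl | rfl | rfl)
    · simp [jet]
    · obtain ⟨m, rfl⟩ := Nat.exists_eq_add_of_le hn
      simp [jet, pow_add, pow_two]
    · simp [jet, show n ≠ 0 by lia]
  obtain ⟨c, hc⟩ := Algebra.mem_bot.1 (hle r.2)
  exact hc ▸ TrivSqZeroExt.snd_inl k c

theorem snd_jet_X_mul (p : MvPolynomial (Fin 2) k) : (jet k (X 0 * p)).snd = constantCoeff p := by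
  have hfst : (TrivSqZeroExt.fstHom k k k).comp (jet k) = aeval 0 := by
    ext i
    fin_cases i <;> simp [jet]
  have hp : (jet k p).fst = constantCoeff p := by
    simpa using DFunLike.congr_fun hfst p
  simp [← hp, jet]

theorem isUnit_of_dvd_X_one_of_dvd_X_zero_pow {p : MvPolynomial (Fin 2) k} {m : ℕ}
    (h1 : p ∣ X 1) (h0 : p ∣ X 0 ^ m) : IsUnit p := by
  by_contra hp
  have h : (X 1 : MvPolynomial (Fin 2) k) ∣ X 0 ^ m :=
    (((X_prime (i := 1)).irreducible.dvd_iff.1 h1).resolve_left hp).dvd.trans h0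
  simpa using map_dvd (aeval (![1, 0] : Fin 2 → k)) h

theorem not_isPrincipal_span (hn : 2 ≤ n) {u v : cyclicSurface k n}
    (hu : (u : MvPolynomial (Fin 2) k) = X 0 * X 1)
    (hv : (v : MvPolynomial (Fin 2) k) = X 0 ^ n) : ¬ (Ideal.span {u, v}).IsPrincipal := by
  rintro ⟨g, hg⟩
  change Ideal.span {u, v} = Ideal.span {g} at hg
  have hgu : (g : MvPolynomial (Fin 2) k) ∣ X 0 * X 1 := hu ▸ map_dvd (cyclicSurface k n).val
    (Ideal.mem_span_singleton.1 (hg ▸ Ideal.subset_span (by simp)))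
  have hgv : (g : MvPolynomial (Fin 2) k) ∣ X 0 ^ n := hv ▸ map_dvd (cyclicSurface k n).val
    (Ideal.mem_span_singleton.1 (hg ▸ Ideal.subset_span (by simp)))
  obtain ⟨a, b, hab⟩ := Ideal.mem_span_pair.1 (hg ▸ Ideal.mem_span_singleton_self g)
  obtain ⟨m, rfl⟩ := Nat.exists_eq_add_of_le' hn
  have hXg : (X 0 : MvPolynomial (Fin 2) k) ∣ g := by
    rw [← hab]
    push_cast
    rw [hu, hv]
    exact dvd_add (Dvd.intro _ rfl |>.mul_left _) ((dvd_pow_self _ (by lia)).mul_left _)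
  obtain ⟨p, hp⟩ := hXg
  rw [hp] at hgu hgv
  rw [pow_succ'] at hgv
  have hunit := isUnit_of_dvd_X_one_of_dvd_X_zero_pow
    ((mul_dvd_mul_iff_left (X_ne_zero 0)).1 hgu) ((mul_dvd_mul_iff_left (X_ne_zero 0)).1 hgv)
  have hzero := snd_jet_eq_zero hn g
  rw [hp, snd_jet_X_mul] at hzero
  exact (hunit.map constantCoeff).ne_zero hzero

end cyclicSurface

set_option synthInstance.maxHeartbeats 1000000 in
set_option maxHeartbeats 1000000 in
/-- Let `k` be a field and `n ≥ 2`.  Then the `k`-subalgebra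
`R = k[xy, xⁿ, yⁿ]` of `k[x,y]` is not a unique factorization domain; indeed the ideal of `R`
generated by `xy` and `xⁿ` is a height-one prime ideal of `R` that is not principal.  Here
`k[x,y]` is realized as `MvPolynomial (Fin 2) k` (with `x, y` the variables of index `0, 1`)
and `R` as `Algebra.adjoin k {xy, xⁿ, yⁿ}`. -/
theorem divisor_class_stmt_15 {k : Type*} [Field k] (n : ℕ) (hn : 2 ≤ n) :
    (∃ hp : (Ideal.span
        {(⟨MvPolynomial.X 0 * MvPolynomial.X 1, Algebra.subset_adjoin (Set.mem_insert _ _)⟩ :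
          Algebra.adjoin k {(MvPolynomial.X 0 * MvPolynomial.X 1 : MvPolynomial (Fin 2) k),
            MvPolynomial.X 0 ^ n, MvPolynomial.X 1 ^ n}),
         ⟨MvPolynomial.X 0 ^ n,
          Algebra.subset_adjoin (Set.mem_insert_of_mem _ (Set.mem_insert _ _))⟩}).IsPrime,
      Order.height (⟨_, hp⟩ : PrimeSpectrum
        (Algebra.adjoin k {(MvPolynomial.X 0 * MvPolynomial.X 1 : MvPolynomial (Fin 2) k),
          MvPolynomial.X 0 ^ n, MvPolynomial.X 1 ^ n})) = 1 ∧
      ¬ Submodule.IsPrincipal (Ideal.span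
        {(⟨MvPolynomial.X 0 * MvPolynomial.X 1, Algebra.subset_adjoin (Set.mem_insert _ _)⟩ :
          Algebra.adjoin k {(MvPolynomial.X 0 * MvPolynomial.X 1 : MvPolynomial (Fin 2) k),
            MvPolynomial.X 0 ^ n, MvPolynomial.X 1 ^ n}),
         ⟨MvPolynomial.X 0 ^ n,
          Algebra.subset_adjoin (Set.mem_insert_of_mem _ (Set.mem_insert _ _))⟩})) ∧
    ¬ UniqueFactorizationMonoid
        (Algebra.adjoin k {(MvPolynomial.X 0 * MvPolynomial.X 1 : MvPolynomial (Fin 2) k),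
          MvPolynomial.X 0 ^ n, MvPolynomial.X 1 ^ n}) := by
  have hp := cyclicSurface.isPrime_span hn
    (u := ⟨MvPolynomial.X 0 * MvPolynomial.X 1, Algebra.subset_adjoin (by simp)⟩)
    (v := ⟨MvPolynomial.X 0 ^ n, Algebra.subset_adjoin (by simp)⟩) (k := k) rfl rfl
  have hheight := cyclicSurface.height_span hn
    (u := ⟨MvPolynomial.X 0 * MvPolynomial.X 1, Algebra.subset_adjoin (by simp)⟩)
    (v := ⟨MvPolynomial.X 0 ^ n, Algebra.subset_adjoin (by simp)⟩) (k := k) rfl rfl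
  have hprincipal := cyclicSurface.not_isPrincipal_span hn
    (u := ⟨MvPolynomial.X 0 * MvPolynomial.X 1, Algebra.subset_adjoin (by simp)⟩)
    (v := ⟨MvPolynomial.X 0 ^ n, Algebra.subset_adjoin (by simp)⟩) (k := k) rfl rfl
  refine ⟨⟨hp, (PrimeSpectrum.height_eq_orderHeight ⟨_, hp⟩).symm.trans hheight, hprincipal⟩, ?_⟩
  intro hufd
  exact hprincipal (Ideal.isPrincipal_of_height_eq_one hheight)
end

section
/- Let k be a field, let d ≥ 4, and let m_1, …, m_d, n be positive integers such that n is relatively prime to each m_i and the characteristic of k is zero or does not divide any m_i. Then the hypersurface ring R = k[z,x_1,…,x_d]/(z^n − x_1^{m_1} − ⋯ − x_d^{m_d}) is a unique factorization domain. -/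
open Polynomial in
/-- A grading of `R` by `ℕ`, given as a coaction `R → R[T]` of the multiplicative monoid of the
affine line: `r` is sent to `∑ rₑ Tᵉ`, where `rₑ` is the component of `r` of degree `e`. -/
structure GradingCoaction (R : Type*) [CommRing R] where
  /-- The ring homomorphism `r ↦ ∑ rₑ Tᵉ`. -/
  toRingHom : R →+* R[X]
  eval_one : ∀ r, (toRingHom r).eval 1 = r
  coeff_homogeneous : ∀ r e,
    toRingHom ((toRingHom r).coeff e) = monomial e ((toRingHom r).coeff e)

namespace GradingCoaction

open Polynomial

variable {R : Type*} [CommRing R] (φ : GradingCoaction R)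

/-- `r` is homogeneous of degree `e`. -/
def IsHomogeneous (e : ℕ) (r : R) : Prop := φ.toRingHom r = monomial e r

lemma toRingHom_ne_zero {r : R} (hr : r ≠ 0) : φ.toRingHom r ≠ 0 := fun h => hr <| by
  rw [← φ.eval_one r, h, eval_zero]

lemma isHomogeneous_of_eq_monomial {e : ℕ} {r c : R} (h : φ.toRingHom r = monomial e c) :
    φ.IsHomogeneous e r := by
  have : c = r := by rw [← φ.eval_one r, h]; simp
  rw [IsHomogeneous, h, this]

variable {φ}

lemma IsHomogeneous.pow {a : ℕ} {r : R} (hr : φ.IsHomogeneous a r) (i : ℕ) :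
    φ.IsHomogeneous (a * i) (r ^ i) := by
  rw [IsHomogeneous, map_pow, hr, monomial_pow]

lemma IsHomogeneous.add {a : ℕ} {r s : R} (hr : φ.IsHomogeneous a r)
    (hs : φ.IsHomogeneous a s) : φ.IsHomogeneous a (r + s) := by
  rw [IsHomogeneous, map_add, hr, hs, map_add]

lemma IsHomogeneous.sum {ι : Type*} (s : Finset ι) {a : ℕ} {r : ι → R}
    (hr : ∀ i ∈ s, φ.IsHomogeneous a (r i)) : φ.IsHomogeneous a (∑ i ∈ s, r i) := by
  rw [IsHomogeneous, map_sum, map_sum]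
  exact Finset.sum_congr rfl hr

lemma IsHomogeneous.mul {a b : ℕ} {r s : R} (hr : φ.IsHomogeneous a r)
    (hs : φ.IsHomogeneous b s) : φ.IsHomogeneous (a + b) (r * s) := by
  rw [IsHomogeneous, map_mul, hr, hs, monomial_mul_monomial]

/-- A homogeneous element which is prime with respect to homogeneous elements is prime. -/
lemma prime_of_homogeneous {e : ℕ} {p : R} (hp0 : p ≠ 0) (hpu : ¬ IsUnit p)
    (hp : φ.IsHomogeneous e p)
    (H : ∀ a b r s, φ.IsHomogeneous a r → φ.IsHomogeneous b s → p ∣ r * s → p ∣ r ∨ p ∣ s) :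
    Prime p := by
  let ψ : R →+* (R ⧸ Ideal.span {p})[X] :=
    (mapRingHom (Ideal.Quotient.mk (Ideal.span {p}))).comp φ.toRingHom
  have hψ (r : R) : ψ r = 0 ↔ p ∣ r := by
    constructor
    · intro h
      have h1 : (ψ r).eval 1 = Ideal.Quotient.mk (Ideal.span {p}) r := by
        conv_rhs => rw [← φ.eval_one r]
        change ((φ.toRingHom r).map _).eval 1 = _
        rw [eval_map, eval₂_at_one]
      rw [h, eval_zero] at h1
      exact Ideal.mem_span_singleton.1 (Ideal.Quotient.eq_zero_iff_mem.1 h1.symm)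
    · rintro ⟨s, rfl⟩
      have h1 : ψ p = 0 := by
        change (φ.toRingHom p).map _ = 0
        rw [hp, map_monomial, Ideal.Quotient.eq_zero_iff_mem.2 (Ideal.mem_span_singleton_self p),
          monomial_zero_right]
      rw [map_mul, h1, zero_mul]
  refine ⟨hp0, hpu, fun f g hfg => ?_⟩
  by_contra! hcon
  have hf := mt (hψ f).1 hcon.1
  have hg := mt (hψ g).1 hcon.2
  have hfg0 : ψ f * ψ g = 0 := by rw [← map_mul]; exact (hψ _).2 hfg
  have hl : (ψ f).leadingCoeff * (ψ g).leadingCoeff = 0 := by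
    by_contra h
    have := leadingCoeff_mul' h
    rw [hfg0, leadingCoeff_zero] at this
    exact h this.symm
  have hc (r : R) (i : ℕ) : (ψ r).coeff i =
      Ideal.Quotient.mk (Ideal.span {p}) ((φ.toRingHom r).coeff i) := coeff_map _ _
  have hz (r : R) : Ideal.Quotient.mk (Ideal.span {p}) r = 0 ↔ p ∣ r := by
    rw [Ideal.Quotient.eq_zero_iff_mem, Ideal.mem_span_singleton]
  have hf' := mt leadingCoeff_eq_zero.1 hf
  have hg' := mt leadingCoeff_eq_zero.1 hg
  rw [leadingCoeff, hc] at hl hf' 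
  rw [leadingCoeff, hc] at hl hg'
  rw [← map_mul, hz] at hl
  rw [hz] at hf' hg'
  exact (H _ _ _ _ (φ.coeff_homogeneous _ _) (φ.coeff_homogeneous _ _) hl).elim hf' hg'

variable (φ) in
/-- The difference between the largest and the smallest degree of a component of `r`. -/
noncomputable def spread (r : R) : ℕ :=
  (φ.toRingHom r).natDegree - (φ.toRingHom r).natTrailingDegree

variable (φ) in
/-- The component of `r` of largest degree. -/
noncomputable def top (r : R) : R := (φ.toRingHom r).leadingCoeff

lemma top_homogeneous (r : R) : φ.IsHomogeneous (φ.toRingHom r).natDegree (φ.top r) :=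
  φ.coeff_homogeneous _ _

lemma top_ne_zero {r : R} (hr : r ≠ 0) : φ.top r ≠ 0 :=
  leadingCoeff_ne_zero.2 (φ.toRingHom_ne_zero hr)

/-- Cancelling the components of largest degree decreases the spread. -/
lemma spread_sub_lt {f g : R} (hfg : φ.spread f ≤ φ.spread g)
    (h : φ.top f * g - φ.top g * f ≠ 0) :
    φ.spread (φ.top f * g - φ.top g * f) < φ.spread g := by
  have hF := natTrailingDegree_le_natDegree (φ.toRingHom f)
  have hG := natTrailingDegree_le_natDegree (φ.toRingHom g)
  set a := (φ.toRingHom f).natDegree with ha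
  set b := (φ.toRingHom g).natDegree with hb
  have key : φ.toRingHom (φ.top f * g - φ.top g * f) =
      C (φ.top f) * (X ^ a * φ.toRingHom g) - C (φ.top g) * (X ^ b * φ.toRingHom f) := by
    rw [map_sub, map_mul, map_mul, φ.top_homogeneous f, φ.top_homogeneous g,
      ← C_mul_X_pow_eq_monomial, ← C_mul_X_pow_eq_monomial, mul_assoc, mul_assoc]
  have h' := φ.toRingHom_ne_zero h
  unfold spread at hfg ⊢
  have h1 : ∀ i, a + b ≤ i → (φ.toRingHom (φ.top f * g - φ.top g * f)).coeff i = 0 := by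
    intro i hi
    rw [key, coeff_sub, coeff_C_mul, coeff_C_mul, coeff_X_pow_mul', coeff_X_pow_mul',
      if_pos (by omega), if_pos (by omega)]
    rcases hi.eq_or_lt with rfl | hi
    · rw [Nat.add_sub_cancel_left, Nat.add_sub_cancel]
      change _ * φ.top g - _ * φ.top f = 0
      ring
    · rw [coeff_eq_zero_of_natDegree_lt (p := φ.toRingHom g) (by omega),
        coeff_eq_zero_of_natDegree_lt (p := φ.toRingHom f) (by omega)]
      ring
  have h2 : (φ.toRingHom (φ.top f * g - φ.top g * f)).natDegree < a + b := by
    by_contra! hcon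
    exact leadingCoeff_ne_zero.2 h' (h1 _ hcon)
  have h3 : a + (φ.toRingHom g).natTrailingDegree ≤
      (φ.toRingHom (φ.top f * g - φ.top g * f)).natTrailingDegree := by
    refine le_natTrailingDegree h' fun i hi => ?_
    rw [key, coeff_sub, coeff_C_mul, coeff_C_mul, coeff_X_pow_mul', coeff_X_pow_mul']
    have e1 : i - a < (φ.toRingHom g).natTrailingDegree ∨ ¬ a ≤ i := by omega
    have e2 : i - b < (φ.toRingHom f).natTrailingDegree ∨ ¬ b ≤ i := by omega
    have z1 : (if a ≤ i then (φ.toRingHom g).coeff (i - a) else 0) = 0 := by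
      split_ifs with hh
      · exact coeff_eq_zero_of_lt_natTrailingDegree (by tauto)
      · rfl
    have z2 : (if b ≤ i then (φ.toRingHom f).coeff (i - b) else 0) = 0 := by
      split_ifs with hh
      · exact coeff_eq_zero_of_lt_natTrailingDegree (by tauto)
      · rfl
    rw [z1, z2, mul_zero, mul_zero, sub_zero]
  have := natTrailingDegree_le_natDegree (φ.toRingHom (φ.top f * g - φ.top g * f))
  omega

section Factorial

variable [IsDomain R]

lemma IsHomogeneous.of_mul_left {e : ℕ} {r s : R} (h : φ.IsHomogeneous e (r * s))
    (h0 : r * s ≠ 0) : ∃ a, φ.IsHomogeneous a r := by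
  have hr := φ.toRingHom_ne_zero (left_ne_zero_of_mul h0)
  have hs := φ.toRingHom_ne_zero (right_ne_zero_of_mul h0)
  rw [IsHomogeneous, map_mul] at h
  have h1 := congrArg natDegree h
  have h2 := congrArg natTrailingDegree h
  rw [natDegree_mul hr hs, natDegree_monomial_eq _ h0] at h1
  rw [natTrailingDegree_mul hr hs, natTrailingDegree_monomial h0] at h2
  have h3 := natTrailingDegree_le_natDegree (φ.toRingHom r)
  have h4 := natTrailingDegree_le_natDegree (φ.toRingHom s)
  refine ⟨_, φ.isHomogeneous_of_eq_monomial (e := (φ.toRingHom r).natDegree)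
    (c := (φ.toRingHom r).leadingCoeff) ?_⟩
  ext i
  rw [coeff_monomial]
  split_ifs with hi
  · rw [← hi]; rfl
  · rcases lt_or_gt_of_ne hi with hi | hi
    · exact coeff_eq_zero_of_natDegree_lt hi
    · exact coeff_eq_zero_of_lt_natTrailingDegree (by omega)

lemma IsHomogeneous.of_dvd {e : ℕ} {r s : R} (h : φ.IsHomogeneous e s) (hs : s ≠ 0)
    (hrs : r ∣ s) : ∃ a, φ.IsHomogeneous a r := by
  obtain ⟨t, rfl⟩ := hrs
  exact h.of_mul_left hs

lemma IsHomogeneous.top_mul {e : ℕ} {p : R} (hp : φ.IsHomogeneous e p) (r : R) :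
    φ.top (p * r) = p * φ.top r := by
  rw [top, map_mul, leadingCoeff_mul, hp, leadingCoeff_monomial]; rfl

lemma IsHomogeneous.spread_mul {e : ℕ} {p r : R} (hp : φ.IsHomogeneous e p) (hp0 : p ≠ 0)
    (hr : r ≠ 0) : φ.spread (p * r) = φ.spread r := by
  have h := φ.toRingHom_ne_zero hr
  have h' := φ.toRingHom_ne_zero hp0
  rw [spread, spread, map_mul, natDegree_mul h' h, natTrailingDegree_mul h' h, hp,
    natDegree_monomial_eq _ hp0, natTrailingDegree_monomial hp0]
  omega

/-- An element of minimal spread in an ideal generates it up to homogeneous denominators. -/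
lemma exists_dvd_homogeneous_mul {P : Ideal R} {f : R} (hf : f ∈ P) (hf0 : f ≠ 0)
    (hmin : ∀ g ∈ P, g ≠ 0 → φ.spread f ≤ φ.spread g) {g : R} (hg : g ∈ P) :
    ∃ e s, φ.IsHomogeneous e s ∧ s ≠ 0 ∧ f ∣ s * g := by
  induction hN : φ.spread g using Nat.strong_induction_on generalizing g with
  | _ N ih =>
    subst hN
    by_cases hg0 : g = 0
    · exact ⟨_, _, φ.top_homogeneous f, top_ne_zero hf0, by simp [hg0]⟩
    set g' := φ.top f * g - φ.top g * f with hg'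
    have hmem : g' ∈ P := P.sub_mem (P.mul_mem_left _ hg) (P.mul_mem_left _ hf)
    have : ∃ e s, φ.IsHomogeneous e s ∧ s ≠ 0 ∧ f ∣ s * g' := by
      by_cases h0 : g' = 0
      · exact ⟨_, _, φ.top_homogeneous f, top_ne_zero hf0, by simp [h0]⟩
      · exact ih _ (spread_sub_lt (hmin g hg hg0) h0) hmem rfl
    obtain ⟨e, s, hs, hs0, hd⟩ := this
    refine ⟨_, s * φ.top f, hs.mul (φ.top_homogeneous f), mul_ne_zero hs0 (top_ne_zero hf0), ?_⟩
    have : s * φ.top f * g = s * g' + f * (s * φ.top g) := by rw [hg']; ring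
    rw [this]
    exact dvd_add hd (dvd_mul_right _ _)

/-- Elements of a prime ideal without nonzero homogeneous elements can be stripped of their
homogeneous prime factors. -/
lemma exists_not_dvd {P : Ideal R} [P.IsPrime]
    (hP : ∀ e r, φ.IsHomogeneous e r → r ∈ P → r = 0) (t : Multiset R) (ht : ∀ p ∈ t, Prime p)
    {f : R} (hf : f ∈ P) (hf0 : f ≠ 0) (htop : Associated t.prod (φ.top f)) :
    ∃ f' ∈ P, f' ≠ 0 ∧ φ.spread f' = φ.spread f ∧
      ∀ e p, φ.IsHomogeneous e p → Prime p → ¬ p ∣ f' := by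
  classical
  induction hc : t.card generalizing t f with
  | zero =>
    refine ⟨f, hf, hf0, rfl, ?_⟩
    rintro e p hp hpp ⟨g, rfl⟩
    rw [Multiset.card_eq_zero.1 hc, Multiset.prod_zero, hp.top_mul] at htop
    exact hpp.not_isUnit (isUnit_of_dvd_unit (dvd_mul_right _ _) (htop.isUnit isUnit_one))
  | succ c ih =>
    by_cases H : ∀ e p, φ.IsHomogeneous e p → Prime p → ¬ p ∣ f
    · exact ⟨f, hf, hf0, rfl, H⟩
    push Not at H
    obtain ⟨e, p, hp, hpp, g, rfl⟩ := H
    have hg0 := right_ne_zero_of_mul hf0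
    rw [hp.top_mul] at htop
    obtain ⟨q, hqt, hpq⟩ := Prime.exists_mem_multiset_dvd hpp
      (htop.dvd_iff_dvd_right.2 (dvd_mul_right p _))
    have hassoc : Associated q p := (hpp.associated_of_dvd (ht q hqt) hpq).symm
    have hgP : g ∈ P := ((‹P.IsPrime›.mem_or_mem hf).resolve_left
      fun h => hpp.ne_zero (hP e p hp h))
    rw [← Multiset.prod_erase hqt] at htop
    obtain ⟨f', h1, h2, h3, h4⟩ := ih (t.erase q)
      (fun r hr => ht r (Multiset.mem_of_mem_erase hr)) hgP hg0
      (htop.of_mul_left hassoc (ht q hqt).ne_zero)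
      (by rw [Multiset.card_erase_of_mem hqt, hc]; rfl)
    exact ⟨f', h1, h2, by rw [h3, hp.spread_mul hpp.ne_zero hg0], h4⟩

/-- A graded domain whose nonzero homogeneous elements are products of primes is factorial. -/
theorem uniqueFactorizationMonoid
    (H : ∀ e r, φ.IsHomogeneous e r → r ≠ 0 →
      ∃ t : Multiset R, (∀ p ∈ t, Prime p) ∧ Associated t.prod r) :
    UniqueFactorizationMonoid R := by
  refine UniqueFactorizationMonoid.iff_exists_prime_mem_of_isPrime.2 fun P hPbot hPprime => ?_
  by_cases hP : ∀ e r, φ.IsHomogeneous e r → r ∈ P → r = 0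
  swap
  · push Not at hP
    obtain ⟨e, r, hr, hrP, hr0⟩ := hP
    obtain ⟨t, ht, hass⟩ := H e r hr hr0
    have : t.prod ∈ P := by
      obtain ⟨u, hu⟩ := hass.symm
      exact hu ▸ P.mul_mem_right _ hrP
    obtain ⟨p, hpt, hpP⟩ := (hPprime.multiset_prod_mem_iff_exists_mem t).1 this
    exact ⟨p, hpP, ht p hpt⟩
  obtain ⟨f₁, hf₁⟩ := Submodule.exists_mem_ne_zero_of_ne_bot hPbot
  let S := {N | ∃ f ∈ P, f ≠ 0 ∧ φ.spread f = N}
  have hS : S.Nonempty := ⟨_, f₁, hf₁.1, hf₁.2, rfl⟩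
  obtain ⟨f₀, hf₀, hf₀0, hf₀S⟩ := Nat.sInf_mem hS
  obtain ⟨t, ht, htop⟩ := H _ _ (φ.top_homogeneous f₀) (top_ne_zero hf₀0)
  obtain ⟨f, hf, hf0, hfs, hnd⟩ := exists_not_dvd hP t ht hf₀ hf₀0 htop
  have hmin : ∀ g ∈ P, g ≠ 0 → φ.spread f ≤ φ.spread g := fun g hg hg0 => by
    rw [hfs, hf₀S]
    exact Nat.sInf_le ⟨g, hg, hg0, rfl⟩
  have hgen : P = Ideal.span {f} := by
    refine le_antisymm (fun g hg => ?_) ((Ideal.span_singleton_le_iff_mem _).2 hf)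
    rw [Ideal.mem_span_singleton]
    obtain ⟨e, s, hs, hs0, hd⟩ := exists_dvd_homogeneous_mul hf hf0 hmin hg
    obtain ⟨t, ht, hts⟩ := H e s hs hs0
    have hprim (p : R) (hp : p ∈ t) : ¬ p ∣ f := by
      obtain ⟨a, ha⟩ := hs.of_dvd hs0 ((Multiset.dvd_prod hp).trans hts.dvd)
      exact hnd a p ha (ht p hp)
    replace hd : f ∣ t.prod * g := (hts.mul_right g).dvd_iff_dvd_right.2 hd
    clear hts
    induction t using Multiset.induction_on with
    | empty => simpa using hd
    | cons p t ih =>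
      refine ih (fun q hq => ht q (Multiset.mem_cons_of_mem hq))
        (fun q hq => hprim q (Multiset.mem_cons_of_mem hq)) ?_
      obtain ⟨c, hc⟩ := hd
      have hp := ht p (Multiset.mem_cons_self p t)
      rw [Multiset.prod_cons, mul_assoc] at hc
      obtain ⟨c', rfl⟩ := (hp.dvd_or_dvd ⟨_, hc.symm⟩).resolve_left
        (hprim p (Multiset.mem_cons_self p t))
      exact ⟨c', mul_left_cancel₀ hp.ne_zero (by rw [hc]; ring)⟩
  refine ⟨f, hf, ?_⟩
  rw [← Ideal.span_singleton_prime hf0, ← hgen]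
  exact hPprime

end Factorial

section MvPolynomial

variable {σ : Type*} (k : Type*) [CommRing k] (w : σ → ℕ)

/-- The coaction of the grading of a polynomial ring in which `X i` has degree `w i`. -/
noncomputable def mvPolynomial : GradingCoaction (MvPolynomial σ k) :=
  let α : MvPolynomial σ k →ₐ[k] (MvPolynomial σ k)[X] :=
    MvPolynomial.aeval fun i => monomial (w i) (MvPolynomial.X i)
  { toRingHom := α
    eval_one := fun r => by
      have : (aeval (1 : MvPolynomial σ k)).toRingHom.comp α.toRingHom = RingHom.id _ := by
        ext i <;> simp [α]
      exact DFunLike.congr_fun this r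
    coeff_homogeneous := fun r e => by
      change α ((α r).coeff e) = monomial e ((α r).coeff e)
      have key (s : σ →₀ ℕ) (c : k) :
          ∃ e, α (MvPolynomial.monomial s c) = monomial e (MvPolynomial.monomial s c) := by
        induction s using Finsupp.induction_linear generalizing c with
        | zero => exact ⟨0, by simp [α, MvPolynomial.algebraMap_eq]⟩
        | add s t hs ht =>
          obtain ⟨a, ha⟩ := hs c
          obtain ⟨b, hb⟩ := ht 1
          refine ⟨a + b, ?_⟩
          rw [← mul_one c, ← MvPolynomial.monomial_mul, map_mul, ha, hb, monomial_mul_monomial]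
        | single i j =>
          refine ⟨w i * j, ?_⟩
          rw [MvPolynomial.monomial_eq]
          simp [α, monomial_pow, MvPolynomial.algebraMap_eq, C_mul_monomial]
      induction r using MvPolynomial.induction_on' with
      | monomial s c =>
        obtain ⟨a, ha⟩ := key s c
        rw [ha, coeff_monomial]
        split_ifs with h
        · rw [ha, h]
        · simp
      | add p q hp hq => rw [map_add, coeff_add, map_add, hp, hq, map_add] }

lemma mvPolynomial_X (i : σ) : (mvPolynomial k w).IsHomogeneous (w i) (MvPolynomial.X i) :=
  MvPolynomial.aeval_X _ i

end MvPolynomial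

section CyclicCover

variable {n M : ℕ} {F : R}

lemma root_pow : AdjoinRoot.root (X ^ n - C F) ^ n = AdjoinRoot.of (X ^ n - C F) F := by
  have := AdjoinRoot.eval₂_root (X ^ n - C F)
  rwa [eval₂_sub, eval₂_X_pow, eval₂_C, sub_eq_zero] at this

variable (n F) in
lemma of_dvd_of (hn : 0 < n) (p a : R) :
    AdjoinRoot.of (X ^ n - C F) p ∣ AdjoinRoot.of (X ^ n - C F) a ↔ p ∣ a := by
  refine ⟨?_, map_dvd _⟩
  rintro ⟨q, hq⟩
  obtain ⟨q, rfl⟩ := AdjoinRoot.mk_surjective q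
  rw [← AdjoinRoot.mk_C, ← AdjoinRoot.mk_C, ← map_mul, AdjoinRoot.mk_eq_mk] at hq
  obtain ⟨h, hh⟩ := hq
  by_contra hpa
  have h1 := congrArg (Polynomial.map (Ideal.Quotient.mk (Ideal.span {p}))) hh
  have hp : Ideal.Quotient.mk (Ideal.span {p}) p = 0 :=
    Ideal.Quotient.eq_zero_iff_mem.2 (Ideal.mem_span_singleton_self p)
  have ha : Ideal.Quotient.mk (Ideal.span {p}) a ≠ 0 := by
    rwa [Ne, Ideal.Quotient.eq_zero_iff_mem, Ideal.mem_span_singleton]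
  have := nontrivial_of_ne _ _ ha
  simp only [Polynomial.map_sub, Polynomial.map_mul, Polynomial.map_pow, map_X, map_C, hp,
    map_zero, zero_mul, sub_zero] at h1
  refine (monic_X_pow_sub_C (Ideal.Quotient.mk (Ideal.span {p}) F) hn.ne').not_dvd_of_natDegree_lt
    (C_ne_zero.2 ha) ?_ ⟨_, h1⟩
  rwa [natDegree_C, natDegree_X_pow_sub_C]

lemma prime_root (hn : 0 < n) (hF : Prime F) : Prime (AdjoinRoot.root (X ^ n - C F)) := by
  have := (Ideal.span_singleton_prime hF.ne_zero).2 hF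
  let ψ : AdjoinRoot (X ^ n - C F) →+* R ⧸ Ideal.span {F} :=
    AdjoinRoot.lift (Ideal.Quotient.mk _) 0 (by
      rw [eval₂_sub, eval₂_X_pow, eval₂_C, zero_pow hn.ne', zero_sub, neg_eq_zero,
        Ideal.Quotient.eq_zero_iff_mem]
      exact Ideal.mem_span_singleton_self F)
  have hψ (r) : ψ r = 0 ↔ AdjoinRoot.root (X ^ n - C F) ∣ r := by
    constructor
    · intro h
      obtain ⟨p, rfl⟩ := AdjoinRoot.mk_surjective r
      rw [AdjoinRoot.lift_mk, eval₂_at_zero, Ideal.Quotient.eq_zero_iff_mem,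
        Ideal.mem_span_singleton] at h
      obtain ⟨a, ha⟩ := h
      rw [← X_mul_divX_add p, ha, map_add, map_mul, AdjoinRoot.mk_X, C_mul, map_mul,
        AdjoinRoot.mk_C, ← root_pow]
      exact dvd_add (dvd_mul_right _ _) ((dvd_pow_self _ hn.ne').mul_right _)
    · rintro ⟨s, rfl⟩
      rw [map_mul, AdjoinRoot.lift_root, zero_mul]
  refine ⟨fun h => ?_, fun h => ?_, fun f g hfg => ?_⟩
  · have h1 := root_pow (n := n) (F := F)
    rw [h, zero_pow hn.ne', ← map_zero (AdjoinRoot.of _)] at h1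
    have := (of_dvd_of n F hn 0 F).1 (by rw [h1])
    exact hF.ne_zero (zero_dvd_iff.1 this)
  · have h1 := (hψ 1).2 h.dvd
    rw [map_one] at h1
    exact one_ne_zero h1
  · rwa [← hψ, map_mul, mul_eq_zero, hψ, hψ] at hfg

/-- The ring homomorphism underlying `GradingCoaction.cyclicCover`. -/
noncomputable def cyclicCoverHom (φ : GradingCoaction R) (hF : φ.IsHomogeneous M F) :
    AdjoinRoot (X ^ n - C F) →+* (AdjoinRoot (X ^ n - C F))[X] :=
  AdjoinRoot.lift
    ((mapRingHom (AdjoinRoot.of _)).comp ((expand R n).toRingHom.comp φ.toRingHom))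
    (monomial M (AdjoinRoot.root _)) (by
      rw [eval₂_sub, eval₂_X_pow, eval₂_C, monomial_pow, root_pow]
      change _ - (expand R n (φ.toRingHom F)).map _ = 0
      rw [hF, expand_monomial, map_monomial, sub_self])

lemma cyclicCoverHom_of_mul_root_pow (hF : φ.IsHomogeneous M F) {e : ℕ} {a : R}
    (ha : φ.IsHomogeneous e a) (j : ℕ) :
    cyclicCoverHom (n := n) φ hF (AdjoinRoot.of _ a * AdjoinRoot.root _ ^ j) =
      monomial (n * e + M * j) (AdjoinRoot.of _ a * AdjoinRoot.root _ ^ j) := by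
  rw [map_mul, map_pow, cyclicCoverHom, AdjoinRoot.lift_root, AdjoinRoot.lift_of, monomial_pow]
  change (expand R n (φ.toRingHom a)).map _ * _ = _
  rw [ha, expand_monomial, map_monomial, monomial_mul_monomial, mul_comm e]

lemma eval_cyclicCoverHom (hF : φ.IsHomogeneous M F) (r : AdjoinRoot (X ^ n - C F)) :
    (cyclicCoverHom φ hF r).eval 1 = r := by
  have : (evalRingHom 1).comp (cyclicCoverHom (n := n) φ hF) = RingHom.id _ := by
    refine AdjoinRoot.ringHom_ext ?_ ?_
    · ext a
      rw [RingHom.comp_apply, RingHom.comp_apply, cyclicCoverHom, AdjoinRoot.lift_of]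
      change ((expand R n (φ.toRingHom a)).map _).eval 1 = _
      rw [← map_one (AdjoinRoot.of _), eval_map_apply, expand_eval, one_pow, φ.eval_one]
      rfl
    · rw [RingHom.comp_apply, cyclicCoverHom, AdjoinRoot.lift_root]
      simp
  exact DFunLike.congr_fun this r

lemma coeff_cyclicCoverHom (hn : 0 < n) (hnM : n.Coprime M) (hF : φ.IsHomogeneous M F)
    (r : AdjoinRoot (X ^ n - C F)) (E : ℕ) :
    (cyclicCoverHom φ hF r).coeff E = 0 ∨ ∃ j e a, j < n ∧ φ.IsHomogeneous e a ∧
      n * e + M * j = E ∧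
      (cyclicCoverHom φ hF r).coeff E = AdjoinRoot.of _ a * AdjoinRoot.root _ ^ j := by
  let T (x : AdjoinRoot (X ^ n - C F)) : Prop := x = 0 ∨ ∃ j e a, j < n ∧
    φ.IsHomogeneous e a ∧ n * e + M * j = E ∧ x = AdjoinRoot.of _ a * AdjoinRoot.root _ ^ j
  have hadd (x y) (hx : T x) (hy : T y) : T (x + y) := by
    rcases hx with rfl | ⟨j, e, a, hj, ha, hE, rfl⟩
    · rwa [zero_add]
    rcases hy with rfl | ⟨j', e', a', hj', ha', hE', rfl⟩
    · rw [add_zero]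
      exact .inr ⟨j, e, a, hj, ha, hE, rfl⟩
    have hjj : j = j' := by
      have h1 : M * j ≡ M * j' [MOD n] := by
        have : n * e + M * j ≡ n * e' + M * j' [MOD n] := by rw [hE, hE']
        simpa [Nat.ModEq, Nat.add_mod] using this
      exact (Nat.ModEq.cancel_left_of_coprime hnM h1).eq_of_lt_of_lt hj hj'
    subst hjj
    have hee : e = e' := Nat.eq_of_mul_eq_mul_left hn (by omega)
    subst hee
    exact .inr ⟨j, e, a + a', hj, ha.add ha', hE, by rw [map_add, add_mul]⟩
  change T _
  obtain ⟨p, rfl⟩ := AdjoinRoot.mk_surjective r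
  induction p using Polynomial.induction_on' with
  | add p q hp hq => rw [map_add, map_add, coeff_add]; exact hadd _ _ hp hq
  | monomial i a =>
    have ha : a = ∑ e ∈ (φ.toRingHom a).support, (φ.toRingHom a).coeff e := by
      conv_lhs => rw [← φ.eval_one a, eval_eq_sum, Polynomial.sum]
      simp
    rw [ha, map_sum, map_sum, map_sum, finsetSum_coeff]
    refine Finset.sum_induction _ T hadd (.inl rfl) fun e _ => ?_
    have hb : φ.IsHomogeneous e ((φ.toRingHom a).coeff e) := φ.coeff_homogeneous a e
    generalize (φ.toRingHom a).coeff e = b at hb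
    have : AdjoinRoot.mk (X ^ n - C F) (monomial i b) =
        AdjoinRoot.of _ (b * F ^ (i / n)) * AdjoinRoot.root _ ^ (i % n) := by
      rw [← C_mul_X_pow_eq_monomial, map_mul, map_pow, AdjoinRoot.mk_X, AdjoinRoot.mk_C, map_mul,
        map_pow, ← root_pow, ← pow_mul, mul_assoc, ← pow_add, Nat.div_add_mod]
    have hb' := hb.mul (hF.pow (i / n))
    rw [this, cyclicCoverHom_of_mul_root_pow hF hb', coeff_monomial]
    split_ifs with h
    · exact .inr ⟨_, _, _, Nat.mod_lt _ hn, hb', h, rfl⟩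
    · exact .inl rfl

/-- The grading of `R[z] / (zⁿ - F)` in which the degrees of `R` are multiplied by `n` and the
degree of `z` is that of `F`. -/
noncomputable def cyclicCover (φ : GradingCoaction R) (hn : 0 < n) (hnM : n.Coprime M)
    (hF : φ.IsHomogeneous M F) : GradingCoaction (AdjoinRoot (X ^ n - C F)) where
  toRingHom := cyclicCoverHom φ hF
  eval_one := eval_cyclicCoverHom hF
  coeff_homogeneous r E := by
    obtain h | ⟨j, e, a, -, ha, rfl, h⟩ := coeff_cyclicCoverHom hn hnM hF r E
    · rw [h, map_zero, map_zero]
    · rw [h, cyclicCoverHom_of_mul_root_pow hF ha]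

lemma exists_eq_of_mul_root_pow (hn : 0 < n) (hnM : n.Coprime M)
    (hF : φ.IsHomogeneous M F) {E : ℕ} {r : AdjoinRoot (X ^ n - C F)}
    (hr : (φ.cyclicCover hn hnM hF).IsHomogeneous E r) :
    ∃ a e j, φ.IsHomogeneous e a ∧ r = AdjoinRoot.of _ a * AdjoinRoot.root _ ^ j := by
  have hr' : (cyclicCoverHom φ hF r).coeff E = r := by
    change ((φ.cyclicCover hn hnM hF).toRingHom r).coeff E = r
    rw [hr, coeff_monomial, if_pos rfl]
  have := coeff_cyclicCoverHom hn hnM hF r E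
  rw [hr'] at this
  obtain rfl | ⟨j, e, a, -, ha, -, h⟩ := this
  · exact ⟨0, 0, 0, by simp [IsHomogeneous], by simp⟩
  · exact ⟨a, e, j, ha, h⟩

lemma prime_of (hn : 0 < n) (hnM : n.Coprime M) (hF : φ.IsHomogeneous M F)
    {p : R} (hp : Prime p) {e : ℕ} (hpe : φ.IsHomogeneous e p) (hpF : ¬ p ∣ F) :
    Prime (AdjoinRoot.of (X ^ n - C F) p) := by
  refine prime_of_homogeneous (φ := φ.cyclicCover hn hnM hF) (e := n * e) (fun h => ?_)
    (fun h => ?_) ?_ fun _ _ r s hr hs hrs => ?_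
  · exact hp.ne_zero (zero_dvd_iff.1 ((of_dvd_of n F hn 0 p).1 (by rw [h, map_zero])))
  · refine hp.not_isUnit (isUnit_of_dvd_one ((of_dvd_of n F hn p 1).1 ?_))
    rw [map_one]
    exact h.dvd
  · have := cyclicCoverHom_of_mul_root_pow (n := n) hF hpe 0
    rwa [pow_zero, mul_one, mul_zero, add_zero] at this
  · obtain ⟨b, _, j, -, rfl⟩ := exists_eq_of_mul_root_pow hn hnM hF hr
    obtain ⟨c, _, l, -, rfl⟩ := exists_eq_of_mul_root_pow hn hnM hF hs
    have h1 : AdjoinRoot.of (X ^ n - C F) p ∣ AdjoinRoot.of _ (b * c * F ^ (j + l)) := by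
      have : AdjoinRoot.of (X ^ n - C F) (b * c * F ^ (j + l)) =
          (AdjoinRoot.of _ b * AdjoinRoot.root _ ^ j * (AdjoinRoot.of _ c * AdjoinRoot.root _ ^ l))
            * AdjoinRoot.root _ ^ ((n - 1) * (j + l)) := by
        have h2 : n * (j + l) = j + l + (n - 1) * (j + l) := by
          obtain ⟨n, rfl⟩ := Nat.exists_eq_succ_of_ne_zero hn.ne'
          simp
          ring
        rw [map_mul, map_mul, map_pow, ← root_pow, ← pow_mul, h2]
        ring
      rw [this]
      exact hrs.mul_right _
    rw [of_dvd_of n F hn] at h1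
    rcases hp.dvd_or_dvd h1 with h1 | h1
    · exact (hp.dvd_or_dvd h1).imp (fun h => (_root_.map_dvd _ h).mul_right _)
        fun h => (_root_.map_dvd _ h).mul_right _
    · exact absurd (hp.dvd_of_dvd_pow h1) hpF

/-- **Samuel's theorem**: if `F` is a homogeneous prime element of a graded factorial domain `R`
and `n` is coprime to the degree of `F`, then `R[z] / (zⁿ - F)` is factorial. -/
theorem uniqueFactorizationMonoid_cyclicCover [IsDomain R] [UniqueFactorizationMonoid R]
    [IsDomain (AdjoinRoot (X ^ n - C F))] (hn : 0 < n) (hnM : n.Coprime M)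
    (hF : φ.IsHomogeneous M F) (hFp : Prime F) :
    UniqueFactorizationMonoid (AdjoinRoot (X ^ n - C F)) := by
  let Q (r : AdjoinRoot (X ^ n - C F)) : Prop :=
    ∃ t : Multiset (AdjoinRoot (X ^ n - C F)), (∀ p ∈ t, Prime p) ∧ Associated t.prod r
  have hmul (r s) (hr : Q r) (hs : Q s) : Q (r * s) := by
    obtain ⟨t, ht, htr⟩ := hr
    obtain ⟨u, hu, hus⟩ := hs
    refine ⟨t + u, fun p hp => (Multiset.mem_add.1 hp).elim (ht p) (hu p), ?_⟩
    rw [Multiset.prod_add]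
    exact htr.mul_mul hus
  have hprime (r) (hr : Prime r) : Q r := ⟨{r}, by simpa using hr, by simp⟩
  have hroot (j : ℕ) : Q (AdjoinRoot.root _ ^ j) :=
    ⟨.replicate j (AdjoinRoot.root _), fun p hp => Multiset.eq_of_mem_replicate hp ▸
      prime_root hn hFp, by simp⟩
  refine uniqueFactorizationMonoid (φ := φ.cyclicCover hn hnM hF) fun E r hr hr0 => ?_
  obtain ⟨a, e, j, ha, rfl⟩ := exists_eq_of_mul_root_pow hn hnM hF hr
  refine hmul _ _ ?_ (hroot j)
  replace hr0 : a ≠ 0 := by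
    rintro rfl
    simp at hr0
  clear hr
  induction a using UniqueFactorizationMonoid.induction_on_prime generalizing e with
  | h₁ => exact absurd rfl hr0
  | h₂ x hx =>
    exact ⟨0, by simp, by simpa using (associated_one_iff_isUnit.2 (hx.map (AdjoinRoot.of _))).symm⟩
  | h₃ a p ha0 hp ih =>
    obtain ⟨i, hi⟩ := ha.of_mul_left hr0
    rw [mul_comm] at ha
    obtain ⟨i', hi'⟩ := ha.of_mul_left (mul_comm p a ▸ hr0)
    rw [map_mul]
    refine hmul _ _ ?_ (ih i' hi' ha0)
    by_cases hpF : p ∣ F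
    · obtain ⟨t, ht, htr⟩ := hroot n
      refine ⟨t, ht, htr.trans ?_⟩
      rw [root_pow]
      exact ((hp.associated_of_dvd hFp hpF).symm).map _
    · exact hprime _ (prime_of hn hnM hF hp hi hpF)

end CyclicCover

end GradingCoaction

open Polynomial in
lemma irreducible_X_pow_sub_C_of_prime {A : Type*} [CommRing A] [IsDomain A] {n : ℕ} (hn : 0 < n)
    {q a : A} (hq : Prime q) (hqa : q ∣ a) (hqa2 : ¬ q ^ 2 ∣ a) :
    Irreducible (X ^ n - C a : A[X]) := by
  have hmonic := monic_X_pow_sub_C a hn.ne'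
  have hdeg : (X ^ n - C a : A[X]).degree = n := degree_X_pow_sub_C hn a
  refine irreducible_of_eisenstein_criterion
    ((Ideal.span_singleton_prime hq.ne_zero).2 hq) ?_ (fun i hi => ?_) ?_ ?_ hmonic.isPrimitive
  · rw [hmonic.leadingCoeff, Ideal.mem_span_singleton]
    exact fun h => hq.not_isUnit (isUnit_of_dvd_one h)
  · rw [hdeg, Nat.cast_lt] at hi
    rw [Ideal.mem_span_singleton, coeff_sub, coeff_X_pow, if_neg hi.ne, zero_sub, dvd_neg, coeff_C]
    split_ifs
    · exact hqa
    · exact dvd_zero q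
  · rw [hdeg]
    exact_mod_cast hn
  · rw [Ideal.span_singleton_pow, Ideal.mem_span_singleton, coeff_sub, coeff_X_pow,
      if_neg hn.ne, zero_sub, dvd_neg, coeff_C_zero]
    exact hqa2

namespace MvPolynomial

variable {k : Type*} [Field k]

lemma exists_prime_dvd_sum_X_pow {σ : Type*} [Fintype σ] [Nontrivial σ] {m : σ → ℕ}
    (hm : ∀ i, 0 < m i) (hck : ∀ i, (m i : k) ≠ 0) :
    ∃ q : MvPolynomial σ k, Prime q ∧ q ∣ ∑ i, X i ^ m i ∧ ¬ q ^ 2 ∣ ∑ i, X i ^ m i := by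
  classical
  set G : MvPolynomial σ k := ∑ i, X i ^ m i with hG
  have hd (i : σ) : pderiv i G = C (m i : k) * X i ^ (m i - 1) := by
    rw [hG, map_sum, Finset.sum_eq_single i]
    · simp
    · intro j _ hj
      simp [pderiv_X_of_ne hj]
    · simp
  obtain ⟨i₀, i₁, hi⟩ := exists_pair_ne σ
  have hG0 : G ≠ 0 := fun h => by
    have := hd i₀
    rw [h, map_zero, eq_comm, mul_eq_zero, C_eq_zero] at this
    exact this.elim (hck i₀) (pow_ne_zero _ (X_ne_zero i₀))
  have hGu : ¬ IsUnit G := fun h => by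
    have := h.map (constantCoeff (σ := σ) (R := k))
    simp [hG, fun i => (hm i).ne'] at this
  obtain ⟨q, hq, hqG⟩ := WfDvdMonoid.exists_irreducible_factor hGu hG0
  have hqp := hq.prime
  refine ⟨q, hqp, hqG, fun ⟨h, hh⟩ => ?_⟩
  have hass (i : σ) : Associated q (X i) := by
    have h1 : q ∣ pderiv i G := by
      rw [hh, pderiv_mul, sq, pderiv_mul]
      exact ⟨2 * pderiv i q * h + q * pderiv i h, by ring⟩
    rw [hd] at h1
    have h2 : IsUnit (C (m i : k) : MvPolynomial σ k) := (IsUnit.mk0 _ (hck i)).map C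
    exact hqp.associated_of_dvd X_prime (hqp.dvd_of_dvd_pow (h2.dvd_mul_left.1 h1))
  exact hi (X_dvd_X.1 ((hass i₀).symm.trans (hass i₁)).dvd)

lemma prime_sum_X_pow {d : ℕ} (hd : 3 ≤ d) {m : Fin d → ℕ} (hm : ∀ i, 0 < m i)
    (hck : ∀ i, (m i : k) ≠ 0) : Prime (∑ i, X i ^ m i : MvPolynomial (Fin d) k) := by
  obtain ⟨d, rfl⟩ : ∃ e, d = e + 2 + 1 := ⟨d - 3, by omega⟩
  obtain ⟨q, hq, h1, h2⟩ :=
    exists_prime_dvd_sum_X_pow (k := k) (m := fun i : Fin (d + 2) => m i.succ)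
    (fun i => hm _) (fun i => hck _)
  have := irreducible_X_pow_sub_C_of_prime (hm 0) hq ((dvd_neg).2 h1) (by rwa [dvd_neg])
  rw [← MulEquiv.prime_iff (finSuccEquiv k (d + 2))]
  convert this.prime using 1
  rw [Fin.sum_univ_succ, map_add, map_pow, finSuccEquiv_X_zero, map_sum]
  simp [finSuccEquiv_X_succ]

end MvPolynomial

/-- Let `k` be a field, `d ≥ 4`, and `m₁, …, m_d, n` positive integers such
that `n` is relatively prime to each `mᵢ` and the characteristic of `k` is zero or does not
divide any `mᵢ` (equivalently, each `mᵢ` is nonzero in `k`).  Then the hypersurface ring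
`R = k[z,x₁,…,x_d]/(zⁿ − x₁^{m₁} − ⋯ − x_d^{m_d})` is a unique factorization domain, i.e. an
integral domain with unique factorization.  Here `k[x₁,…,x_d]` is realized as
`MvPolynomial (Fin d) k` and `R` as the quotient of the polynomial ring in `z` over it. -/
theorem divisor_class_stmt_16 {k : Type*} [Field k] {d n : ℕ} (hd : 4 ≤ d) (hn : 0 < n)
    (m : Fin d → ℕ) (hm : ∀ i, 0 < m i) (hnm : ∀ i, Nat.Coprime n (m i))
    (hck : ∀ i, (m i : k) ≠ 0) :
    ∃ hdom : IsDomain (Polynomial (MvPolynomial (Fin d) k) ⧸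
        Ideal.span {Polynomial.X ^ n - Polynomial.C
          (∑ i, MvPolynomial.X i ^ m i : MvPolynomial (Fin d) k)}),
      letI := hdom
      UniqueFactorizationMonoid (Polynomial (MvPolynomial (Fin d) k) ⧸
        Ideal.span {Polynomial.X ^ n - Polynomial.C
          (∑ i, MvPolynomial.X i ^ m i : MvPolynomial (Fin d) k)}) := by
  have hF := MvPolynomial.prime_sum_X_pow (k := k) (by omega) hm hck
  have hhom : (GradingCoaction.mvPolynomial k fun i => ∏ j ∈ Finset.univ.erase i, m j).IsHomogeneous
      (∏ j, m j) (∑ i, MvPolynomial.X i ^ m i) :=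
    .sum _ fun i hi => by
      rw [← Finset.prod_erase_mul _ _ hi]
      exact (GradingCoaction.mvPolynomial_X k _ i).pow (m i)
  have hirr := irreducible_X_pow_sub_C_of_prime hn hF dvd_rfl fun ⟨c, hc⟩ => hF.not_isUnit <|
    isUnit_of_dvd_one ⟨c, mul_left_cancel₀ hF.ne_zero (by rw [mul_one, ← mul_assoc, ← sq, ← hc])⟩
  have hdom := AdjoinRoot.isDomain_of_prime hirr.prime
  exact ⟨hdom, GradingCoaction.uniqueFactorizationMonoid_cyclicCover hn
    (Nat.Coprime.prod_right fun i _ => hnm i) hhom hF⟩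
end
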